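/- arXiv:1910.11286 — 8 statements merged into one kernel-verified Lean document; each statement's English description precedes it below -/
import Mathlib

section
/- Let m, n, k_1, …, k_m be nonnegative integers with k_1 + ⋯ + k_m = n. For nonnegative integers a ≥ b, write B(a,b)_q for the polynomial Σ_τ q^{inv(τ)}, summed over all sequences τ of length a with entries in {1,2} having exactly b entries equal to 2. Then the product B(n, k_m)_q · B(n − k_m, k_{m−1})_q · ⋯ · B(n − k_m − ⋯ − k_2, k_1)_q is equal to Σ_{σ ∈ S(n,m; k_1,…,k_m)} q^{inv(σ)}. -/
open Finset Polynomial

/-- Number of inversions of a sequence. -/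
def invStat {n m : ℕ} (σ : Fin n → Fin m) : ℕ :=
  ((Finset.univ : Finset (Fin n × Fin n)).filter fun p => p.1 < p.2 ∧ σ p.2 < σ p.1).card

/-- `B(a,b)_q`: the generating polynomial `Σ_τ q^{inv τ}` over sequences `τ` of length `a`
with entries in `{1, 2}` (encoded as `Fin 2`, `0 ↦ 1`, `1 ↦ 2`) having exactly `b`
entries equal to `2`. -/
noncomputable def qBinomB (a b : ℕ) : Polynomial ℤ :=
  ∑ τ ∈ (Finset.univ : Finset (Fin a → Fin 2)).filter
      (fun τ => (Finset.univ.filter fun x => τ x = 1).card = b),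
    X ^ invStat τ

/-- Extending a word along an order embedding by the largest letter: its inversions are those of
the indicator word of the new letter together with those of the original word. -/
theorem invStat_eq_add {n N m : ℕ} (e : Fin N ↪o Fin n) (τ : Fin n → Fin 2)
    (hτ : ∀ a, τ a = 0 ↔ a ∈ Set.range e) (ρ : Fin N → Fin m) (σ : Fin n → Fin (m + 1))
    (hρ : ∀ x, σ (e x) = (ρ x).castSucc) (hσ : ∀ a, τ a = 1 → σ a = Fin.last m) :
    invStat σ = invStat τ + invStat ρ := by
  have hτ01 : ∀ a, τ a = 0 ∨ τ a = 1 := fun a => by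
    generalize τ a = t; fin_cases t <;> simp
  have hzero : ∀ a, τ a = 0 → σ a < Fin.last m := by
    intro a ha
    obtain ⟨x, rfl⟩ := (hτ a).1 ha
    rw [hρ]
    exact Fin.castSucc_lt_last _
  unfold invStat
  rw [← Finset.card_filter_add_card_filter_not (fun p : Fin n × Fin n => τ p.1 = 1),
    Finset.filter_filter, Finset.filter_filter]
  congr 1
  · congr 1
    ext p
    simp only [Finset.mem_filter, Finset.mem_univ, true_and]
    constructor
    · rintro ⟨⟨h1, h2⟩, h3⟩
      refine ⟨h1, ?_⟩
      rcases hτ01 p.2 with h | h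
      · rw [h, h3]; decide
      · rw [hσ _ h, hσ _ h3] at h2
        exact absurd h2 (lt_irrefl _)
    · rintro ⟨h1, h2⟩
      rcases hτ01 p.1 with h | h
      · rw [h] at h2
        exact absurd h2 (Fin.not_lt_zero _)
      · rcases hτ01 p.2 with h' | h'
        · exact ⟨⟨h1, by rw [hσ _ h]; exact hzero _ h'⟩, h⟩
        · rw [h, h'] at h2
          exact absurd h2 (lt_irrefl _)
  · rw [← Finset.card_map (e.toEmbedding.prodMap e.toEmbedding)]
    congr 1
    ext ⟨a, b⟩
    simp only [Finset.mem_filter, Finset.mem_univ, true_and, Finset.mem_map, Prod.exists,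
      Function.Embedding.coe_prodMap, Prod.map_apply, Prod.mk.injEq, RelEmbedding.coe_toEmbedding]
    constructor
    · rintro ⟨⟨h1, h2⟩, h3⟩
      obtain ⟨x, rfl⟩ := (hτ a).1 ((hτ01 a).resolve_right h3)
      have hb : τ b ≠ 1 := fun h => by
        rw [hσ _ h] at h2
        exact absurd h2 (Fin.le_last _).not_gt
      obtain ⟨y, rfl⟩ := (hτ b).1 ((hτ01 b).resolve_right hb)
      rw [hρ, hρ, Fin.castSucc_lt_castSucc_iff] at h2
      exact ⟨x, y, ⟨e.lt_iff_lt.1 h1, h2⟩, rfl, rfl⟩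
    · rintro ⟨x, y, ⟨h1, h2⟩, rfl, rfl⟩
      refine ⟨⟨e.lt_iff_lt.2 h1, ?_⟩, ?_⟩
      · rwa [hρ, hρ, Fin.castSucc_lt_castSucc_iff]
      · rw [(hτ _).2 ⟨x, rfl⟩]; decide

/-- The generating polynomial of inversions over the words with a prescribed set of positions of
the largest letter. -/
theorem sum_invStat_fiber {n m : ℕ} (k : Fin (m + 1) → ℕ) (τ : Fin n → Fin 2)
    (hτk : (Finset.univ.filter fun x => τ x = 1).card = k (Fin.last m)) :
    (∑ σ ∈ (Finset.univ : Finset (Fin n → Fin (m + 1))).filter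
        (fun σ => (∀ j, (Finset.univ.filter fun a => σ a = j).card = k j) ∧
          (fun a => if σ a = Fin.last m then (1 : Fin 2) else 0) = τ),
      (X : Polynomial ℤ) ^ invStat σ) =
    X ^ invStat τ *
      ∑ ρ ∈ (Finset.univ : Finset (Fin (n - k (Fin.last m)) → Fin m)).filter
        (fun ρ => ∀ j, (Finset.univ.filter fun a => ρ a = j).card = k j.castSucc),
      (X : Polynomial ℤ) ^ invStat ρ := by
  have hτ01 : ∀ a, τ a ≠ 1 ↔ τ a = 0 := fun a => by
    generalize τ a = t; fin_cases t <;> simp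
  have hcard : (Finset.univ.filter fun x => τ x = 0).card = n - k (Fin.last m) := by
    have h := Finset.card_filter_add_card_filter_not (s := Finset.univ) (fun x => τ x = 1)
    simp only [hτ01, Finset.card_univ, Fintype.card_fin] at h
    omega
  let e := (Finset.univ.filter fun x => τ x = 0).orderEmbOfFin hcard
  have he : ∀ a, τ a = 0 ↔ a ∈ Set.range e := fun a => by
    simp [e, Finset.range_orderEmbOfFin]
  have he0 : ∀ x, τ (e x) = 0 := fun x => (he _).2 ⟨x, rfl⟩
  have hcount : ∀ (ρ : Fin (n - k (Fin.last m)) → Fin m) (σ : Fin n → Fin (m + 1)),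
      (∀ x, σ (e x) = (ρ x).castSucc) → (∀ a, τ a = 1 → σ a = Fin.last m) → ∀ j,
      (Finset.univ.filter fun a => σ a = Fin.castSucc j).card =
        (Finset.univ.filter fun a => ρ a = j).card := by
    intro ρ σ hρ hσ j
    rw [← Finset.card_map e.toEmbedding]
    congr 1
    ext a
    simp only [Finset.mem_filter, Finset.mem_univ, true_and, Finset.mem_map,
      RelEmbedding.coe_toEmbedding]
    constructor
    · intro h
      have ha : τ a ≠ 1 := fun h' => by
        rw [hσ _ h'] at h
        exact (Fin.castSucc_lt_last j).ne' h
      obtain ⟨x, rfl⟩ := (he a).1 ((hτ01 a).1 ha)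
      rw [hρ] at h
      exact ⟨x, Fin.castSucc_injective _ h, rfl⟩
    · rintro ⟨x, rfl, rfl⟩
      exact hρ x
  let glue : (Fin (n - k (Fin.last m)) → Fin m) → Fin n → Fin (m + 1) := fun ρ =>
    Function.extend e (fun x => (ρ x).castSucc) (fun _ => Fin.last m)
  have hglue : ∀ ρ x, glue ρ (e x) = (ρ x).castSucc := fun ρ x => e.injective.extend_apply _ _ x
  have hglue1 : ∀ ρ a, τ a = 1 → glue ρ a = Fin.last m := fun ρ a ha => by
    refine Function.extend_apply' _ _ _ fun h => ?_
    exact (hτ01 a).2 ((he a).2 h) ha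
  have hglueτ : ∀ ρ a, glue ρ a = Fin.last m ↔ τ a = 1 := fun ρ a => by
    refine ⟨fun h => ?_, hglue1 ρ a⟩
    by_contra h'
    obtain ⟨x, rfl⟩ := (he a).1 ((hτ01 a).1 h')
    rw [hglue] at h
    exact (Fin.castSucc_lt_last _).ne h
  rw [Finset.mul_sum]
  symm
  refine Finset.sum_bij (fun ρ _ => glue ρ) ?_ ?_ ?_ ?_
  · intro ρ hρ
    simp only [Finset.mem_filter, Finset.mem_univ, true_and] at hρ ⊢
    refine ⟨fun j => ?_, ?_⟩
    · induction j using Fin.lastCases with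
      | last => simpa only [hglueτ] using hτk
      | cast j => rw [hcount ρ _ (hglue ρ) (hglue1 ρ), hρ]
    · funext a
      simp only [hglueτ]
      split_ifs with h
      · exact h.symm
      · exact ((hτ01 a).1 h).symm
  · intro ρ _ ρ' _ h
    funext x
    have := congrFun h (e x)
    rw [hglue, hglue] at this
    exact Fin.castSucc_injective _ this
  · intro σ hσ
    simp only [Finset.mem_filter, Finset.mem_univ, true_and] at hσ
    obtain ⟨hσk, hστ⟩ := hσ
    have hlast : ∀ a, σ a = Fin.last m ↔ τ a = 1 := fun a => by
      rw [← hστ]; simp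
    have hex : ∀ x, ∃ y : Fin m, y.castSucc = σ (e x) := fun x =>
      Fin.exists_castSucc_eq.2 fun h => (hτ01 _).2 (he0 x) ((hlast _).1 h)
    choose ρ hρ using hex
    refine ⟨ρ, ?_, ?_⟩
    · simp only [Finset.mem_filter, Finset.mem_univ, true_and]
      intro j
      rw [← hcount ρ σ (fun x => (hρ x).symm) (fun a => (hlast a).2), hσk]
    · funext a
      by_cases ha : τ a = 1
      · rw [hglue1 ρ a ha, (hlast a).2 ha]
      · obtain ⟨x, rfl⟩ := (he a).1 ((hτ01 a).1 ha)
        rw [hglue, hρ]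
  · intro ρ _
    rw [← pow_add, invStat_eq_add e τ he ρ (glue ρ) (hglue ρ) (hglue1 ρ)]

/-- Splitting off the largest letter from the inversion generating polynomial of a multiset. -/
theorem sum_invStat_succ {n m : ℕ} (k : Fin (m + 1) → ℕ) :
    (∑ σ ∈ (Finset.univ : Finset (Fin n → Fin (m + 1))).filter
        (fun σ => ∀ j, (Finset.univ.filter fun a => σ a = j).card = k j),
      (X : Polynomial ℤ) ^ invStat σ) =
    qBinomB n (k (Fin.last m)) *
      ∑ ρ ∈ (Finset.univ : Finset (Fin (n - k (Fin.last m)) → Fin m)).filter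
        (fun ρ => ∀ j, (Finset.univ.filter fun a => ρ a = j).card = k j.castSucc),
      (X : Polynomial ℤ) ^ invStat ρ := by
  rw [qBinomB, Finset.sum_mul, ← Finset.sum_fiberwise_of_maps_to
    (g := fun (σ : Fin n → Fin (m + 1)) a => if σ a = Fin.last m then (1 : Fin 2) else 0)
    (t := Finset.univ.filter fun τ : Fin n → Fin 2 =>
      (Finset.univ.filter fun x => τ x = 1).card = k (Fin.last m))]
  · refine Finset.sum_congr rfl fun τ hτ => ?_
    rw [Finset.filter_filter]
    exact sum_invStat_fiber k τ (Finset.mem_filter.1 hτ).2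
  · intro σ hσ
    simp only [Finset.mem_filter, Finset.mem_univ, true_and] at hσ ⊢
    simpa using hσ (Fin.last m)

/-- `B(n, k_m)_q ⋯ B(n - k_m - ⋯ - k_2, k_1)_q` equals the generating
polynomial of inversions over `S(n, m; k_1, …, k_m)` (sequences of length `n` with entries
in `{1, …, m}`, encoded as `Fin m`, with exactly `k_j` entries equal to `j`). -/
theorem stmt1 (m n : ℕ) (k : Fin m → ℕ) (hk : ∑ i, k i = n) :
    (∏ i : Fin m, qBinomB (n - ∑ j ∈ Finset.univ.filter (fun j => i < j), k j) (k i))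
    =
    ∑ σ ∈ (Finset.univ : Finset (Fin n → Fin m)).filter
        (fun σ => ∀ j, (Finset.univ.filter fun a => σ a = j).card = k j),
      (X : Polynomial ℤ) ^ invStat σ := by
  induction m generalizing n with
  | zero =>
    obtain rfl : n = 0 := by simpa using hk.symm
    simp [invStat]
  | succ m ih =>
    rw [Fin.sum_univ_castSucc] at hk
    rw [sum_invStat_succ, ← ih _ (fun j => k j.castSucc) (by omega), Fin.prod_univ_castSucc,
      mul_comm]
    congr 1
    · simp [(Fin.le_last _).not_gt]
    · refine Finset.prod_congr rfl fun i _ => ?_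
      congr 1
      simp only [Finset.sum_filter, Fin.sum_univ_castSucc, Fin.castSucc_lt_castSucc_iff,
        Fin.castSucc_lt_last, if_true]
      omega
end

section
/- For all nonnegative integers m and n, the cardinality of S(n,m) equals the cardinality of the fundamental Mahonian set F(n,m); that is, the number of fundamental sequences in F(n,m) is m^n. -/
open Finset

/-- A tuple of multisets of total size `n` in which every element of the `j`-th multiset is at most
the total size of the preceding ones. -/
def IsFundamental {m : ℕ} (n : ℕ) (F : Fin m → Multiset ℕ) : Prop :=
  (∑ j, Multiset.card (F j)) = n ∧
    ∀ j : Fin m, ∀ x ∈ F j, x ≤ ∑ i ∈ Finset.univ.filter (fun i => i < j), Multiset.card (F i)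

/-- Multisets of size `k` with all elements at most `a` are the `k`-th symmetric power of
`Fin (a + 1)`. -/
theorem bijective_map_val_sym_fin (a k : ℕ) :
    Function.Bijective (fun s : Sym (Fin (a + 1)) k =>
      (⟨s.1.map Fin.val, by simp, fun x hx => by
        obtain ⟨y, -, rfl⟩ := Multiset.mem_map.1 hx
        exact y.is_le⟩ : {s : Multiset ℕ // Multiset.card s = k ∧ ∀ x ∈ s, x ≤ a})) := by
  constructor
  · intro s t h
    exact Subtype.ext (Multiset.map_injective Fin.val_injective (congrArg Subtype.val h))
  · rintro ⟨s, hs, hsa⟩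
    refine ⟨⟨s.map (Fin.ofNat (a + 1)), by simpa using hs⟩, Subtype.ext ?_⟩
    simp only [Multiset.map_map]
    conv_rhs => rw [← Multiset.map_id s]
    refine Multiset.map_congr rfl fun x hx => ?_
    simpa using Nat.lt_succ_of_le (hsa x hx)

theorem finite_multiset_card_le (a k : ℕ) :
    Finite {s : Multiset ℕ // Multiset.card s = k ∧ ∀ x ∈ s, x ≤ a} :=
  Finite.of_surjective _ (bijective_map_val_sym_fin a k).surjective

theorem natCard_multiset_card_le (a k : ℕ) :
    Nat.card {s : Multiset ℕ // Multiset.card s = k ∧ ∀ x ∈ s, x ≤ a} = (a + k).choose k := by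
  rw [← Nat.card_eq_of_bijective _ (bijective_map_val_sym_fin a k), Nat.card_eq_fintype_card,
    Sym.card_sym_eq_choose, Fintype.card_fin]
  congr 1
  omega

theorem filter_lt_castSucc {m : ℕ} (j : Fin m) :
    Finset.univ.filter (fun i => i < j.castSucc) =
      (Finset.univ.filter (fun i => i < j)).map Fin.castSuccEmb := by
  ext i
  induction i using Fin.lastCases <;> simp [Fin.le_last]

theorem filter_lt_last (m : ℕ) :
    Finset.univ.filter (fun i => i < Fin.last m) = Finset.univ.map Fin.castSuccEmb := by
  ext i
  induction i using Fin.lastCases <;> simp [Fin.castSucc_lt_last]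

theorem isFundamental_snoc {m n : ℕ} (G : Fin m → Multiset ℕ) (s : Multiset ℕ) :
    IsFundamental n (Fin.snoc G s : Fin (m + 1) → Multiset ℕ) ↔
      ∃ a ≤ n, IsFundamental a G ∧ Multiset.card s = n - a ∧ ∀ x ∈ s, x ≤ a := by
  simp only [IsFundamental, Fin.sum_univ_castSucc, Fin.forall_fin_succ', filter_lt_castSucc,
    filter_lt_last, Finset.sum_map, Fin.coe_castSuccEmb, Fin.snoc_castSucc, Fin.snoc_last]
  constructor
  · rintro ⟨h, hG, hs⟩
    exact ⟨_, by omega, ⟨rfl, hG⟩, by omega, hs⟩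
  · rintro ⟨a, ha, ⟨rfl, hG⟩, hc, hs⟩
    exact ⟨by omega, hG, hs⟩

/-- Appending a last multiset to a fundamental tuple yields every fundamental tuple once. -/
theorem bijective_snoc_isFundamental (m n : ℕ) :
    Function.Bijective (fun p : Σ a : Fin (n + 1), {G : Fin m → Multiset ℕ // IsFundamental a.1 G} ×
        {s : Multiset ℕ // Multiset.card s = n - a.1 ∧ ∀ x ∈ s, x ≤ a.1} =>
      (⟨Fin.snoc p.2.1.1 p.2.2.1,
        (isFundamental_snoc _ _).2 ⟨p.1.1, p.1.is_le, p.2.1.2, p.2.2.2⟩⟩ :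
        {F : Fin (m + 1) → Multiset ℕ // IsFundamental n F})) := by
  constructor
  · rintro ⟨⟨a, ha⟩, ⟨G, hG⟩, ⟨s, hs⟩⟩ ⟨⟨b, hb⟩, ⟨H, hH⟩, ⟨t, ht⟩⟩ h
    have h' : (Fin.snoc G s : Fin (m + 1) → Multiset ℕ) = Fin.snoc H t := congrArg Subtype.val h
    obtain ⟨rfl, rfl⟩ := Fin.snoc_inj.1 h'
    obtain rfl : a = b := hG.1.symm.trans hH.1
    rfl
  · rintro ⟨F, hF⟩
    rw [← Fin.snoc_init_self F, isFundamental_snoc] at hF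
    obtain ⟨a, ha, hG, hs⟩ := hF
    exact ⟨⟨⟨a, Nat.lt_succ_of_le ha⟩, ⟨_, hG⟩, ⟨_, hs⟩⟩, Subtype.ext (Fin.snoc_init_self F)⟩

theorem finite_isFundamental (m n : ℕ) :
    Finite {F : Fin m → Multiset ℕ // IsFundamental n F} := by
  induction m generalizing n with
  | zero => infer_instance
  | succ m ih =>
    have := finite_multiset_card_le
    exact Finite.of_surjective _ (bijective_snoc_isFundamental m n).surjective

theorem natCard_isFundamental (m n : ℕ) :
    Nat.card {F : Fin m → Multiset ℕ // IsFundamental n F} = m ^ n := by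
  induction m generalizing n with
  | zero =>
    rcases n with _ | n
    · have : Nonempty {F : Fin 0 → Multiset ℕ // IsFundamental 0 F} :=
        ⟨⟨Fin.elim0, by simp [IsFundamental]⟩⟩
      simp
    · have : IsEmpty {F : Fin 0 → Multiset ℕ // IsFundamental (n + 1) F} :=
        ⟨fun F => by simpa using F.2.1⟩
      simp
  | succ m ih =>
    have := finite_multiset_card_le
    have := finite_isFundamental m
    rw [← Nat.card_eq_of_bijective _ (bijective_snoc_isFundamental m n), Nat.card_sigma, add_pow]
    simp only [Nat.cast_id]
    rw [← Fin.sum_univ_eq_sum_range (fun k => m ^ k * 1 ^ (n - k) * n.choose k)]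
    refine Finset.sum_congr rfl fun a _ => ?_
    rw [Nat.card_prod, ih, natCard_multiset_card_le, Nat.add_sub_cancel' a.is_le,
      Nat.choose_symm a.is_le, one_pow, mul_one]

/-- the number of sequences in `S(n,m)` (functions `Fin n → Fin m`) equals
the number of fundamental sequences in the fundamental Mahonian set `F(n,m)`
(`m`-tuples `(F_1, …, F_m)` of multisets of nonnegative integers with
`|F_1| + ⋯ + |F_m| = n` such that every element `x` of `F_{j+1}` satisfies
`x ≤ |F_1| + ⋯ + |F_j|`), and both equal `m ^ n`. -/
theorem stmt2 (m n : ℕ) :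
    Nat.card (Fin n → Fin m)
      = Nat.card {F : Fin m → Multiset ℕ //
          (∑ j, Multiset.card (F j)) = n ∧
          ∀ j : Fin m, ∀ x ∈ F j, x ≤ ∑ i ∈ Finset.univ.filter (fun i => i < j),
            Multiset.card (F i)} ∧
    Nat.card {F : Fin m → Multiset ℕ //
          (∑ j, Multiset.card (F j)) = n ∧
          ∀ j : Fin m, ∀ x ∈ F j, x ≤ ∑ i ∈ Finset.univ.filter (fun i => i < j),
            Multiset.card (F i)} = m ^ n := by
  have h := natCard_isFundamental m n
  simp only [IsFundamental] at h
  exact ⟨by rw [h]; simp, h⟩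
end

section
/- Let m and n be positive integers and k a nonnegative integer with k < n. Then the cardinality of P(k,m) equals the number of tuples (F_1, …, F_{m+1}) in F(n, m+1; k) such that 0 ∉ F_2, 0 ∉ F_3, …, and 0 ∉ F_{m+1}. -/
open Finset

theorem Multiset.card_le_sum_of_pos {s : Multiset ℕ} (hs : ∀ x ∈ s, 0 < x) :
    Multiset.card s ≤ s.sum := by
  simpa using Multiset.card_nsmul_le_sum (a := 1) hs

theorem Multiset.add_card_le_sum_add_one {s : Multiset ℕ} (hs : ∀ x ∈ s, 0 < x) {x : ℕ}
    (hx : x ∈ s) : x + Multiset.card s ≤ s.sum + 1 := by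
  obtain ⟨t, rfl⟩ := Multiset.exists_cons_of_mem hx
  have ht := card_le_sum_of_pos fun y hy => hs y (Multiset.mem_cons_of_mem hy)
  simp only [Multiset.card_cons, Multiset.sum_cons]
  omega

/-- An entry of a family of multisets of positive integers, plus the number of entries from its
index onwards, exceeds the total of the family by at most one. -/
theorem add_sum_card_le_sum_add_one {ι : Type*} (t : Finset ι) {F : ι → Multiset ℕ}
    (hF : ∀ i ∈ t, ∀ x ∈ F i, 0 < x) {j : ι} (hj : j ∈ t) {x : ℕ} (hx : x ∈ F j) :
    x + ∑ i ∈ t, Multiset.card (F i) ≤ ∑ i ∈ t, (F i).sum + 1 := by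
  classical
  rw [← Finset.add_sum_erase t _ hj, ← Finset.add_sum_erase t (fun i => (F i).sum) hj]
  have h₁ := Multiset.add_card_le_sum_add_one (hF j hj) hx
  have h₂ : ∑ i ∈ t.erase j, Multiset.card (F i) ≤ ∑ i ∈ t.erase j, (F i).sum :=
    Finset.sum_le_sum fun i hi => Multiset.card_le_sum_of_pos (hF i (Finset.mem_of_mem_erase hi))
  omega

/-- If only the first multiset of a family may contain zeros, and the total of the family is less
than the number `n` of its entries, then each entry in a later multiset is at most the number of
entries before that multiset. -/
theorem le_sum_card_of_sum_lt {m n : ℕ} {F : Fin (m + 1) → Multiset ℕ}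
    (hcard : ∑ j, Multiset.card (F j) = n) (hsum : ∑ j, (F j).sum < n)
    (hF : ∀ j, j ≠ 0 → ∀ x ∈ F j, 0 < x) {j : Fin (m + 1)} (hj : j ≠ 0) {x : ℕ} (hx : x ∈ F j) :
    x ≤ ∑ i ∈ Finset.univ.filter (fun i => i < j), Multiset.card (F i) := by
  have h₁ := add_sum_card_le_sum_add_one (Finset.univ.filter fun i => ¬ i < j) (F := F) (j := j)
    (fun i hi => hF i fun h => by
      simp only [Finset.mem_filter, h, not_lt] at hi
      exact hj (Fin.le_zero_iff.mp hi.2)) (by simp) hx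
  have h₂ := Finset.sum_filter_add_sum_filter_not Finset.univ (fun i => i < j)
    fun i => Multiset.card (F i)
  have h₃ : ∑ i ∈ Finset.univ.filter (fun i => ¬ i < j), (F i).sum ≤ ∑ i, (F i).sum :=
    Finset.sum_le_sum_of_subset (Finset.filter_subset _ _)
  omega

/-- for positive integers `m, n` and a nonnegative integer `k < n`, the number
of integer partitions of `k` with `m` kinds (tuples `(P_1, …, P_m)` of multisets of positive
integers whose elements sum, with multiplicity, to `k`) equals the number of fundamental
sequences `(F_1, …, F_{m+1})` in `F(n, m+1; k)` such that `0 ∉ F_j` for every `j ≥ 2`. -/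
theorem stmt4 (m n k : ℕ) (hm : 0 < m) (hn : 0 < n) (hk : k < n) :
    Nat.card {P : Fin m → Multiset ℕ //
        (∀ i, ∀ x ∈ P i, 0 < x) ∧ (∑ i, (P i).sum) = k}
    = Nat.card {F : Fin (m + 1) → Multiset ℕ //
        (∑ j, Multiset.card (F j)) = n ∧
        (∀ j : Fin (m + 1), ∀ x ∈ F j, x ≤ ∑ i ∈ Finset.univ.filter (fun i => i < j),
          Multiset.card (F i)) ∧
        (∑ j, (F j).sum) = k ∧
        (∀ j : Fin (m + 1), j ≠ 0 → (0 : ℕ) ∉ F j)} := by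
  refine Nat.card_congr
    { toFun := fun P => ⟨Fin.cons (Multiset.replicate (n - ∑ i, Multiset.card (P.1 i)) 0) P.1, ?_⟩
      invFun := fun F => ⟨Fin.tail F.1, ?_⟩
      left_inv := fun P => Subtype.ext rfl
      right_inv := ?_ }
  · obtain ⟨P, hpos, hsum⟩ := P
    set F : Fin (m + 1) → Multiset ℕ :=
      Fin.cons (Multiset.replicate (n - ∑ i, Multiset.card (P i)) 0) P with hFdef
    have hle : ∑ i, Multiset.card (P i) ≤ ∑ i, (P i).sum :=
      Finset.sum_le_sum fun i _ => Multiset.card_le_sum_of_pos (hpos i)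
    have hcard : ∑ j, Multiset.card (F j) = n := by
      simp only [hFdef, Fin.sum_univ_succ, Fin.cons_zero, Fin.cons_succ, Multiset.card_replicate]
      omega
    have hFsum : ∑ j, (F j).sum = k := by
      simp [hFdef, Fin.sum_univ_succ, hsum]
    have hF : ∀ j, j ≠ 0 → ∀ x ∈ F j, 0 < x := by
      intro j hj
      obtain ⟨i, rfl⟩ := Fin.exists_succ_eq.mpr hj
      simpa only [hFdef, Fin.cons_succ] using hpos i
    refine ⟨hcard, fun j x hx => ?_, hFsum, fun j hj h => (hF j hj 0 h).false⟩
    by_cases hj : j = 0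
    · subst hj
      simp only [hFdef, Fin.cons_zero] at hx
      simp [Multiset.eq_of_mem_replicate hx]
    · exact le_sum_card_of_sum_lt hcard (hFsum ▸ hk) hF hj hx
  · obtain ⟨F, -, hle, hsum, hzero⟩ := F
    refine ⟨fun i x hx => Nat.pos_of_ne_zero fun h => hzero i.succ (Fin.succ_ne_zero i) (h ▸ hx),
      ?_⟩
    have h₀ : (F 0).sum = 0 := Multiset.sum_eq_zero fun x hx => by simpa using hle 0 x hx
    rw [Fin.sum_univ_succ, h₀, zero_add] at hsum
    exact hsum
  · rintro ⟨F, hcard, hle, -, -⟩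
    have h₀ : F 0 = Multiset.replicate (Multiset.card (F 0)) 0 :=
      Multiset.eq_replicate_card.mpr fun x hx => by simpa using hle 0 x hx
    have hn₀ : n - ∑ i, Multiset.card (Fin.tail F i) = Multiset.card (F 0) := by
      rw [Fin.sum_univ_succ] at hcard
      simp only [Fin.tail]
      omega
    refine Subtype.ext ?_
    simp only [hn₀, ← h₀, Fin.cons_self_tail]
end

section
/- Let m, n, t be nonnegative integers; let p_1, …, p_t be nonnegative integers with p_1 + ⋯ + p_t = n; for each (i,j) ∈ {1,…,t} × {1,…,m} let ℓ_{i,j} be nonnegative integers with ℓ_{i,1} + ⋯ + ℓ_{i,m} = p_i; let d_i = p_1 + ⋯ + p_i (with d_0 = 0); and let T be the set of sequences σ ∈ S(n,m) such that for every u ∈ {1,…,t} the block (σ_{d_{u−1}+1}, …, σ_{d_u}) lies in S(p_u, m; ℓ_{u,1}, …, ℓ_{u,m}). Then Σ_{σ ∈ T} q^{inv(σ)} = q^E · [p_1; ℓ_{1,1}, …, ℓ_{1,m}]_q ⋯ [p_t; ℓ_{t,1}, …, ℓ_{t,m}]_q, where E = Σ_{u=1}^{t} Σ_{v=2}^{m}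 ℓ_{u,v} · ( Σ_{i=u+1}^{t} Σ_{j=1}^{v−1} ℓ_{i,j} ). -/
open Finset Polynomial

/-- The `q`-multinomial coefficient `[n; k_1, …, k_m]_q`, defined as the generating
polynomial `Σ_σ q^{inv σ}` over the set `S(n, m; k_1, …, k_m)` of sequences of length `n`
with entries in `{1, …, m}` (encoded as `Fin m`) having exactly `k_j` entries equal to
`j` for each `j`. -/
noncomputable def qMultinomial (n m : ℕ) (k : Fin m → ℕ) : Polynomial ℤ :=
  ∑ σ ∈ (Finset.univ : Finset (Fin n → Fin m)).filter
      (fun σ => ∀ j, (Finset.univ.filter fun a => σ a = j).card = k j),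
    X ^ invStat σ

theorem invStat_eq_sum {n m : ℕ} (σ : Fin n → Fin m) :
    invStat σ = ∑ a, ∑ b, if a < b ∧ σ b < σ a then 1 else 0 := by
  rw [invStat, card_filter, Fintype.sum_prod_type]

theorem sum_comp_eq_sum_mul {α β : Type*} [Fintype α] [Fintype β] [DecidableEq β]
    (f : α → β) (k : β → ℕ) (hk : ∀ b, #{a | f a = b} = k b) (g : β → ℕ) :
    ∑ a, g (f a) = ∑ b, k b * g b := by
  rw [← sum_fiberwise univ f]
  refine sum_congr rfl fun b _ => ?_
  rw [sum_congr rfl (fun a ha => by rw [(mem_filter.mp ha).2] : ∀ a ∈ _, g (f a) = g b),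
    sum_const, hk, smul_eq_mul]

/-- The number of inversions between two sequences depends only on their contents. -/
theorem sum_cross_inversions {m r s : ℕ} (σ : Fin r → Fin m) (τ : Fin s → Fin m)
    (k l : Fin m → ℕ) (hk : ∀ j, #{a | σ a = j} = k j) (hl : ∀ j, #{a | τ a = j} = l j) :
    (∑ x, ∑ y, if τ y < σ x then 1 else 0) =
      ∑ v ∈ univ.filter (fun v : Fin m => 0 < (v : ℕ)), k v * ∑ j with j < v, l j := by
  rw [sum_comp_eq_sum_mul σ k hk fun v => ∑ y, if τ y < v then 1 else 0]
  have key : ∀ v : Fin m, (∑ y, if τ y < v then 1 else 0) = ∑ j with j < v, l j := fun v => by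
    rw [sum_comp_eq_sum_mul τ l hl fun j => if j < v then 1 else 0, sum_filter]
    simp
  simp only [key]
  refine (sum_filter_of_ne fun v _ hv => ?_).symm
  by_contra h
  refine hv (mul_eq_zero_of_right _ (sum_eq_zero fun j hj => ?_))
  have := Fin.lt_def.mp (mem_filter.mp hj).2
  omega

theorem coe_finSigmaFinEquiv {t : ℕ} (p : Fin t → ℕ) (u : Fin t) (x : Fin (p u)) :
    (finSigmaFinEquiv ⟨u, x⟩ : ℕ) = (∑ i with i < u, p i) + x := by
  rw [finSigmaFinEquiv_apply]
  congr 1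
  refine sum_bij (fun i _ => Fin.castLE u.2.le i) (fun i _ => ?_) (fun i _ j _ h => ?_)
    (fun i hi => ?_) (fun _ _ => rfl)
  · exact mem_filter.mpr ⟨mem_univ _, Fin.lt_def.mpr i.2⟩
  · simpa [Fin.ext_iff] using h
  · exact ⟨⟨i, (mem_filter.mp hi).2⟩, mem_univ _, rfl⟩

theorem sum_filter_lt_add_le {t : ℕ} (p : Fin t → ℕ) {u v : Fin t} (h : u < v) :
    (∑ i with i < u, p i) + p u ≤ ∑ i with i < v, p i := by
  rw [add_comm, ← sum_insert (by simp : u ∉ univ.filter (· < u))]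
  refine sum_le_sum_of_subset fun i hi => ?_
  simp only [mem_insert, mem_filter, mem_univ, true_and] at hi ⊢
  rcases hi with rfl | hi
  · exact h
  · exact hi.trans h

theorem finSigmaFinEquiv_lt_of_lt {t : ℕ} (p : Fin t → ℕ) {u v : Fin t} (h : u < v)
    (x : Fin (p u)) (y : Fin (p v)) :
    finSigmaFinEquiv (n := p) ⟨u, x⟩ < finSigmaFinEquiv ⟨v, y⟩ := by
  rw [Fin.lt_def, coe_finSigmaFinEquiv, coe_finSigmaFinEquiv]
  have := sum_filter_lt_add_le p h
  omega

theorem finSigmaFinEquiv_lt_iff {t : ℕ} (p : Fin t → ℕ) {u : Fin t} (x y : Fin (p u)) :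
    finSigmaFinEquiv (n := p) ⟨u, x⟩ < finSigmaFinEquiv ⟨u, y⟩ ↔ x < y := by
  rw [Fin.lt_def, coe_finSigmaFinEquiv, coe_finSigmaFinEquiv, Fin.lt_def]
  omega

/-- A sequence of length `p_1 + ⋯ + p_t` is the same as a family of blocks of lengths `p_u`. -/
def blockEquiv {t : ℕ} (p : Fin t → ℕ) (α : Type*) :
    (Fin (∑ i, p i) → α) ≃ (∀ u, Fin (p u) → α) :=
  (finSigmaFinEquiv.arrowCongr (Equiv.refl α)).symm.trans (Equiv.piCurry fun _ _ => α)

theorem blockEquiv_apply {t : ℕ} (p : Fin t → ℕ) {α : Type*} (σ : Fin (∑ i, p i) → α)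
    (u : Fin t) (x : Fin (p u)) : blockEquiv p α σ u x = σ (finSigmaFinEquiv ⟨u, x⟩) := rfl

theorem card_block_filter {t : ℕ} (p : Fin t → ℕ) {α : Type*} [DecidableEq α]
    (σ : Fin (∑ i, p i) → α) (u : Fin t) (j : α) :
    #{a : Fin (∑ i, p i) | (∑ i with i < u, p i) ≤ (a : ℕ) ∧
      (a : ℕ) < (∑ i with i < u, p i) + p u ∧ σ a = j} = #{x | blockEquiv p α σ u x = j} := by
  symm
  refine card_bij (fun x _ => finSigmaFinEquiv ⟨u, x⟩) (fun x hx => ?_) (fun x _ y _ h => ?_)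
    (fun a ha => ?_)
  · have hj := (mem_filter.mp hx).2
    rw [mem_filter, coe_finSigmaFinEquiv]
    exact ⟨mem_univ _, by omega, by omega, hj⟩
  · simpa using h
  · obtain ⟨-, h1, h2, h3⟩ := mem_filter.mp ha
    have he : finSigmaFinEquiv ⟨u, ⟨a - ∑ i with i < u, p i, by omega⟩⟩ = a := by
      rw [Fin.ext_iff, coe_finSigmaFinEquiv]
      simp only
      omega
    refine ⟨_, mem_filter.mpr ⟨mem_univ _, ?_⟩, he⟩
    rw [blockEquiv_apply, he, h3]

theorem invStat_eq_sum_blocks {t m : ℕ} (p : Fin t → ℕ) (σ : Fin (∑ i, p i) → Fin m) :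
    invStat σ = (∑ u, ∑ i with u < i, ∑ x, ∑ y,
        if blockEquiv p (Fin m) σ i y < blockEquiv p (Fin m) σ u x then 1 else 0) +
      ∑ u, invStat (blockEquiv p (Fin m) σ u) := by
  rw [invStat_eq_sum, ← finSigmaFinEquiv.sum_comp, Fintype.sum_sigma, ← sum_add_distrib]
  refine sum_congr rfl fun u _ => ?_
  simp_rw [← (finSigmaFinEquiv (n := p)).sum_comp, Fintype.sum_sigma]
  rw [sum_comm, sum_filter, invStat_eq_sum,
    ← Fintype.sum_ite_eq u fun _ => (∑ x, ∑ y, if x < y ∧ blockEquiv p (Fin m) σ u y <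
      blockEquiv p (Fin m) σ u x then 1 else 0 : ℕ), ← sum_add_distrib]
  refine sum_congr rfl fun i _ => ?_
  rcases lt_trichotomy u i with h | rfl | h
  · simp only [h, h.ne, finSigmaFinEquiv_lt_of_lt p h, if_true, if_false, true_and, add_zero]
    rfl
  · simp only [finSigmaFinEquiv_lt_iff, lt_irrefl, if_false, if_true, zero_add]
    rfl
  · simp [h.not_gt, h.ne', (finSigmaFinEquiv_lt_of_lt p h _ _).not_gt]

/-- the "chunk" lemma. Let `p_1 + ⋯ + p_t = n` and for each block `u` let
`ℓ_{u,1} + ⋯ + ℓ_{u,m} = p_u`. Let `T` be the set of sequences `σ ∈ S(n,m)` whose `u`-th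
block (the entries with positions in `(d_{u−1}, d_u]`, where `d_u = p_1 + ⋯ + p_u`)
has exactly `ℓ_{u,j}` entries equal to `j` for each `j`. Then
`Σ_{σ ∈ T} q^{inv σ} = q^E · ∏_u [p_u; ℓ_{u,1}, …, ℓ_{u,m}]_q` with
`E = Σ_u Σ_{v≥2} ℓ_{u,v} (Σ_{i>u} Σ_{j<v} ℓ_{i,j})`. -/
theorem stmt8 (m n t : ℕ) (p : Fin t → ℕ) (hp : ∑ i, p i = n)
    (L : Fin t → Fin m → ℕ) (hL : ∀ i, ∑ j, L i j = p i) :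
    (∑ σ ∈ (Finset.univ : Finset (Fin n → Fin m)).filter
        (fun σ => ∀ u : Fin t, ∀ j : Fin m,
          (Finset.univ.filter fun a : Fin n =>
            (∑ i ∈ Finset.univ.filter (fun i => i < u), p i) ≤ (a : ℕ) ∧
            (a : ℕ) < (∑ i ∈ Finset.univ.filter (fun i => i < u), p i) + p u ∧
            σ a = j).card = L u j),
      (X : Polynomial ℤ) ^ invStat σ)
    =
    X ^ (∑ u : Fin t, ∑ v ∈ Finset.univ.filter (fun v : Fin m => 0 < (v : ℕ)),
          L u v * ∑ i ∈ Finset.univ.filter (fun i => u < i),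
            ∑ j ∈ Finset.univ.filter (fun j => j < v), L i j) *
      ∏ u : Fin t, qMultinomial (p u) m (L u) := by
  subst hp
  simp only [qMultinomial]
  rw [prod_univ_sum, mul_sum]
  refine sum_equiv (blockEquiv p (Fin m)) (fun σ => ?_) fun σ hσ => ?_
  · simp only [card_block_filter, mem_filter, mem_univ, true_and, Fintype.mem_piFinset]
  · simp only [card_block_filter, mem_filter, mem_univ, true_and] at hσ
    rw [invStat_eq_sum_blocks, pow_add, prod_pow_eq_pow_sum]
    congr 2
    refine sum_congr rfl fun u _ => ?_
    rw [sum_congr rfl fun i _ => sum_cross_inversions _ _ _ _ (hσ u) (hσ i), sum_comm]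
    simp only [mul_sum]
end

section
/- Let n_1, …, n_j, k be nonnegative integers with n_j ≤ n_{j−1} ≤ ⋯ ≤ n_1 and k ≤ n_1 + ⋯ + n_j. Then ( Π_{i=2}^{j} C(n_{i−1}, n_i) ) · C(n_1 + ⋯ + n_j, k) = Σ C(n_1, k_1) · Π_{i=2}^{j} C(n_{i−1}; n_{i−1} − n_i, n_i − k_i, k_i), where the sum is over all nonnegative integers k_1, …, k_j with k_1 + ⋯ + k_j = k, k_1 ≤ n_1, and k_i ≤ n_i for every i ∈ {2,…,j}. -/
open Finset

/-- The generalized Vandermonde identity. -/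
theorem Nat.sum_choose_eq_sum_piFinset_prod_choose {ι : Type*} [Fintype ι] [DecidableEq ι]
    (n : ι → ℕ) (k : ℕ) :
    (∑ i, n i).choose k =
      ∑ K ∈ (Fintype.piFinset fun i => Finset.Iic (n i)).filter (fun K : ι → ℕ => ∑ i, K i = k),
        ∏ i, (n i).choose (K i) := by
  have expand (m : ℕ) : (1 + Polynomial.X : Polynomial ℕ) ^ m =
      ∑ l ∈ Finset.Iic m, Polynomial.monomial l (m.choose l) := by
    ext d
    simp [Polynomial.coeff_one_add_X_pow, Polynomial.coeff_monomial,
      Nat.choose_eq_zero_iff]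
  have hprod (K : ι → ℕ) : ∏ i, Polynomial.monomial (K i) ((n i).choose (K i)) =
      Polynomial.monomial (∑ i, K i) (∏ i, (n i).choose (K i)) := by
    simp_rw [← Polynomial.C_mul_X_pow_eq_monomial]
    rw [Finset.prod_mul_distrib, Finset.prod_pow_eq_pow_sum, map_prod]
  have h := Polynomial.coeff_one_add_X_pow ℕ (∑ i, n i) k
  rw [← Finset.prod_pow_eq_pow_sum, Finset.prod_congr rfl fun i _ => expand (n i),
    Finset.prod_univ_sum, Polynomial.finsetSum_coeff] at h
  simp_rw [hprod, Polynomial.coeff_monomial] at h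
  rw [← Finset.sum_filter] at h
  exact h.symm

theorem Nat.multinomial_sub_sub_eq_choose_mul_choose {a b c : ℕ} (hba : b ≤ a) (hcb : c ≤ b) :
    Nat.multinomial Finset.univ ![a - b, b - c, c] = a.choose b * b.choose c := by
  have h := Nat.multinomial_spec Finset.univ ![a - b, b - c, c]
  simp only [Fin.prod_univ_three, Fin.sum_univ_three, Matrix.cons_val] at h
  rw [show a - b + (b - c) + c = a by omega, ← Nat.choose_mul_factorial_mul_factorial hba,
    ← Nat.choose_mul_factorial_mul_factorial hcb] at h
  apply Nat.eq_of_mul_eq_mul_left (by positivity :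
    0 < (a - b).factorial * (b - c).factorial * c.factorial)
  rw [h]
  ring

/-- the "apartment complex" identity. For `n_j ≤ ⋯ ≤ n_1` and
`k ≤ n_1 + ⋯ + n_j`,
`(∏_{i=2}^j C(n_{i−1}, n_i)) C(n_1 + ⋯ + n_j, k)
  = Σ_{k_1+⋯+k_j=k} C(n_1, k_1) ∏_{i=2}^j C(n_{i−1}; n_{i−1}−n_i, n_i−k_i, k_i)`,
the sum over nonnegative `k_i` with `k_1 ≤ n_1` and `k_i ≤ n_i`. (Indices are 0-based:
`n ⟨0, hj⟩` is `n_1`, and the products over `i = 2, …, j` range over `i : Fin j` with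
`0 < i`.) -/
theorem stmt14 (j : ℕ) (hj : 0 < j) (n : Fin j → ℕ)
    (hmono : ∀ a b : Fin j, a ≤ b → n b ≤ n a) (k : ℕ) (hk : k ≤ ∑ i, n i) :
    (∏ i ∈ Finset.univ.filter (fun i : Fin j => 0 < (i : ℕ)),
        Nat.choose (n ⟨(i : ℕ) - 1, by have := i.isLt; omega⟩) (n i)) *
      Nat.choose (∑ i, n i) k
    =
    ∑ K ∈ (Fintype.piFinset fun i => Finset.Iic (n i)).filter
        (fun K : Fin j → ℕ => ∑ i, K i = k),
      Nat.choose (n ⟨0, hj⟩) (K ⟨0, hj⟩) *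
        ∏ i ∈ Finset.univ.filter (fun i : Fin j => 0 < (i : ℕ)),
          Nat.multinomial Finset.univ
            ![n ⟨(i : ℕ) - 1, by have := i.isLt; omega⟩ - n i, n i - K i, K i] := by
  rw [Nat.sum_choose_eq_sum_piFinset_prod_choose, Finset.mul_sum]
  refine Finset.sum_congr rfl fun K hK => ?_
  have hKn (i : Fin j) : K i ≤ n i := by
    simpa using Fintype.mem_piFinset.mp (Finset.mem_filter.mp hK).1 i
  have hzero : Finset.univ.filter (fun i : Fin j => ¬ 0 < (i : ℕ)) = {⟨0, hj⟩} := by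
    ext i
    simp [Fin.ext_iff]
  rw [← Finset.prod_filter_mul_prod_filter_not Finset.univ (fun i : Fin j => 0 < (i : ℕ))
      fun i => (n i).choose (K i),
    hzero, Finset.prod_singleton, ← mul_assoc, ← Finset.prod_mul_distrib, mul_comm]
  congr 1
  refine Finset.prod_congr rfl fun i _ => ?_
  exact (Nat.multinomial_sub_sub_eq_choose_mul_choose
    (hmono _ _ (Fin.mk_le_of_le_val (Nat.sub_le _ _))) (hKn i)).symm
end

section
/- Let n_1, …, n_j, k be nonnegative integers with n_j ≤ n_{j−1} ≤ ⋯ ≤ n_1 and k ≤ n_1 + ⋯ + n_j. Then ( Π_{i=2}^{j} [n_{i−1} choose n_i]_q ) · [n_1 + ⋯ + n_j choose k]_q = Σ q^{f(K)} · [n_1 choose k_1]_q · Π_{i=2}^{j} [n_{i−1}; n_{i−1} − n_i, n_i − k_i, k_i]_q, where the sum is over all tuples K = (k_1, …, k_j) of nonnegative integers with k_1 + ⋯ + k_j = k, k_1 ≤ n_1 and k_i ≤ n_i for i ∈ {2,…,j}, and f(K) = Σ_{u=1}^{j−1} k_u · ( Σ_{i=u+1}^{j} (n_i − k_i) ). 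-/
open Finset Polynomial

/-- The `q`-binomial coefficient `[n choose k]_q = [n; k, n−k]_q`. -/
noncomputable def qBinom (n k : ℕ) : Polynomial ℤ := qMultinomial n 2 ![k, n - k]

theorem invStat_cons {n m : ℕ} (j : Fin m) (τ : Fin n → Fin m) :
    invStat (Fin.cons j τ : Fin (n + 1) → Fin m) =
      #{a | τ a < j} + invStat τ := by
  simp only [invStat, Finset.card_filter, Fintype.sum_prod_type, Fin.sum_univ_succ]
  simp

theorem card_cons_eq {n m : ℕ} (j i : Fin m) (τ : Fin n → Fin m) :
    #{a | (Fin.cons j τ : Fin (n + 1) → Fin m) a = i} =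
      (if j = i then 1 else 0) + #{a | τ a = i} := by
  simp only [Finset.card_filter, Fin.sum_univ_succ]
  simp

theorem card_lt_eq_sum_card_eq {n m : ℕ} (j : Fin m) (τ : Fin n → Fin m) :
    #{a | τ a < j} = ∑ i ∈ Iio j, #{a | τ a = i} := by
  rw [Finset.card_eq_sum_card_fiberwise (f := τ) (t := Iio j)]
  · refine Finset.sum_congr rfl fun i hi => ?_
    rw [Finset.filter_filter]
    congr 1
    ext a
    simp only [mem_filter, mem_univ, true_and, mem_Iio] at hi ⊢
    grind
  · intro a ha
    simpa using ha

theorem qMultinomial_zero (m : ℕ) : qMultinomial 0 m 0 = 1 := by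
  simp [qMultinomial, invStat]

theorem qMultinomial_eq_zero_of_sum_ne {n m : ℕ} {k : Fin m → ℕ} (h : ∑ j, k j ≠ n) :
    qMultinomial n m k = 0 := by
  rw [qMultinomial, Finset.filter_false_of_mem, Finset.sum_empty]
  intro σ _ hσ
  apply h
  simp only [← hσ]
  rw [← Finset.card_eq_sum_card_fiberwise (f := σ) (s := univ) (t := univ) (by simp)]
  simp

/-- Splitting off the first letter of a word. -/
theorem qMultinomial_succ (n m : ℕ) (k : Fin m → ℕ) :
    qMultinomial (n + 1) m k = ∑ j, if k j = 0 then 0 else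
      X ^ (∑ i ∈ Iio j, k i) * qMultinomial n m (Function.update k j (k j - 1)) := by
  rw [qMultinomial, Finset.sum_filter, ← (Fin.consEquiv fun _ => Fin m).sum_comp,
    Fintype.sum_prod_type]
  refine Finset.sum_congr rfl fun j _ => ?_
  split_ifs with hj
  · refine Finset.sum_eq_zero fun τ _ => if_neg fun h => ?_
    have := (card_cons_eq j j τ).symm.trans (h j)
    simp [hj] at this
  · rw [qMultinomial, Finset.sum_filter, Finset.mul_sum]
    refine Finset.sum_congr rfl fun τ _ => ?_
    have hiff : (∀ i, (if j = i then 1 else 0) + #{a | τ a = i} = k i) ↔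
        ∀ i, #{a | τ a = i} = Function.update k j (k j - 1) i := by
      refine forall_congr' fun i => ?_
      by_cases h : j = i
      · subst h; simp; omega
      · simp [h, Function.update_of_ne (Ne.symm h)]
    by_cases h : ∀ i, #{a | τ a = i} = Function.update k j (k j - 1) i
    · rw [if_pos h]
      refine (if_pos fun i => (card_cons_eq j i τ).trans (hiff.2 h i)).trans ?_
      refine (congrArg (X ^ ·) (invStat_cons j τ)).trans ?_
      rw [← pow_add, card_lt_eq_sum_card_eq]
      refine congrArg (X ^ ·) (congrArg (· + _) (Finset.sum_congr rfl fun i hi => ?_))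
      rw [h i, Function.update_of_ne (Finset.mem_Iio.1 hi).ne]
    · rw [if_neg h, mul_zero]
      exact if_neg fun h' => h (hiff.1 fun i => (card_cons_eq j i τ).symm.trans (h' i))

/-- The `q`-integer `1 + q + ⋯ + q^(n-1)`. -/
noncomputable def qInt (n : ℕ) : ℤ[X] := ∑ i ∈ range n, X ^ i

/-- The `q`-factorial. -/
noncomputable def qFactorial (n : ℕ) : ℤ[X] := ∏ i ∈ range n, qInt (i + 1)

theorem qInt_add (a b : ℕ) : qInt (a + b) = qInt a + X ^ a * qInt b := by
  simp [qInt, Finset.sum_range_add, pow_add, Finset.mul_sum]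

theorem qFactorial_succ (n : ℕ) : qFactorial (n + 1) = qFactorial n * qInt (n + 1) :=
  Finset.prod_range_succ _ _

theorem qInt_succ_ne_zero (n : ℕ) : qInt (n + 1) ≠ 0 := by
  intro h
  have := congrArg (Polynomial.eval 1) h
  simp [qInt, Polynomial.eval_finsetSum] at this
  omega

theorem qFactorial_ne_zero (n : ℕ) : qFactorial n ≠ 0 :=
  Finset.prod_ne_zero_iff.2 fun i _ => qInt_succ_ne_zero i

theorem sum_X_pow_mul_qInt : ∀ (m : ℕ) (k : Fin m → ℕ),
    ∑ j, X ^ (∑ i ∈ Iio j, k i) * qInt (k j) = qInt (∑ j, k j)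
  | 0, k => by simp [qInt]
  | m + 1, k => by
    have h (j : Fin m) : ∑ i ∈ Iio j.castSucc, k i = ∑ i ∈ Iio j, k i.castSucc := by
      rw [← Fin.map_castSuccEmb_Iio, Finset.sum_map]; rfl
    have h' : ∑ i ∈ Iio (Fin.last m), k i = ∑ i : Fin m, k i.castSucc := by
      simp only [← Finset.filter_gt_eq_Iio, Finset.sum_filter, Fin.sum_univ_castSucc]
      simp [Fin.castSucc_lt_last]
    rw [Fin.sum_univ_castSucc, Fin.sum_univ_castSucc, qInt_add, h',
      ← sum_X_pow_mul_qInt m fun i => k i.castSucc]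
    simp only [h]

theorem qMultinomial_mul_prod_qFactorial (n m : ℕ) (k : Fin m → ℕ) (hk : ∑ j, k j = n) :
    qMultinomial n m k * ∏ j, qFactorial (k j) = qFactorial n := by
  induction n generalizing k with
  | zero =>
    have h0 : k = 0 := by
      ext j
      simpa using (Finset.sum_eq_zero_iff.1 hk) j (mem_univ j)
    subst h0
    simp [qMultinomial_zero, qFactorial]
  | succ n ih =>
    rw [qMultinomial_succ, qFactorial_succ, ← hk, ← sum_X_pow_mul_qInt, Finset.mul_sum,
      Finset.sum_mul]
    refine Finset.sum_congr rfl fun j _ => ?_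
    split_ifs with hj
    · simp [hj, qInt]
    · obtain ⟨c, hc⟩ := Nat.exists_eq_succ_of_ne_zero hj
      have hsum : ∑ i, Function.update k j (k j - 1) i = n := by
        rw [Finset.sum_update_of_mem (mem_univ j)]
        rw [← Finset.add_sum_erase _ _ (mem_univ j), Finset.erase_eq] at hk
        omega
      rw [← ih _ hsum, ← Finset.mul_prod_erase _ _ (mem_univ j),
        ← Finset.mul_prod_erase (a := j) _ (fun i => qFactorial (Function.update k j _ i))
          (mem_univ j)]
      have he : ∏ i ∈ univ.erase j, qFactorial (Function.update k j (k j - 1) i) =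
          ∏ i ∈ univ.erase j, qFactorial (k i) :=
        Finset.prod_congr rfl fun i hi => by
          rw [Function.update_of_ne (Finset.ne_of_mem_erase hi)]
      rw [he, Function.update_self, hc, Nat.succ_eq_add_one, qFactorial_succ,
        Nat.add_sub_cancel]
      ring

theorem qBinom_mul_qFactorial {n k : ℕ} (hk : k ≤ n) :
    qBinom n k * (qFactorial k * qFactorial (n - k)) = qFactorial n := by
  simpa [qBinom, Fin.prod_univ_succ] using
    qMultinomial_mul_prod_qFactorial n 2 ![k, n - k] (by simp; omega)

theorem qMultinomial_three_eq_mul {a b c : ℕ} (hb : b ≤ a) (hc : c ≤ b) :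
    qMultinomial a 3 ![a - b, b - c, c] = qBinom a b * qBinom b c := by
  have h := qMultinomial_mul_prod_qFactorial a 3 ![a - b, b - c, c]
    (by simp [Fin.sum_univ_succ]; omega)
  simp only [Fin.prod_univ_succ, Matrix.cons_val_zero, Matrix.cons_val_succ, univ_eq_empty,
    prod_empty, mul_one] at h
  have h1 := qBinom_mul_qFactorial hb
  have h2 := qBinom_mul_qFactorial hc
  have hne : qFactorial (a - b) * (qFactorial (b - c) * qFactorial c) ≠ 0 := by
    simp [qFactorial_ne_zero]
  apply mul_right_cancel₀ hne
  rw [h, ← h1, ← h2]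
  ring

theorem qBinom_eq_zero_of_lt {n k : ℕ} (h : n < k) : qBinom n k = 0 :=
  qMultinomial_eq_zero_of_sum_ne (by simp; omega)

theorem qBinom_zero_right (n : ℕ) : qBinom n 0 = 1 := by
  have h := qBinom_mul_qFactorial (Nat.zero_le n)
  have h0 : qFactorial 0 = 1 := by simp [qFactorial]
  rw [h0, one_mul, Nat.sub_zero] at h
  exact mul_right_cancel₀ (qFactorial_ne_zero n) (h.trans (one_mul _).symm)

theorem qBinom_succ_succ (n k : ℕ) :
    qBinom (n + 1) (k + 1) = qBinom n k + X ^ (k + 1) * qBinom n (k + 1) := by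
  have hI0 : Iio (0 : Fin 2) = ∅ := rfl
  have hI1 : Iio (1 : Fin 2) = {0} := rfl
  have hu0 (a b c : ℕ) : Function.update ![a, b] 0 c = ![c, b] := by
    ext i; fin_cases i <;> simp
  have hu1 (a b c : ℕ) : Function.update ![a, b] 1 c = ![a, c] := by
    ext i; fin_cases i <;> simp
  rw [qBinom, qMultinomial_succ, Fin.sum_univ_two, hI0, hI1]
  simp only [Matrix.cons_val_zero, Matrix.cons_val_one, hu0, hu1, Nat.add_sub_add_right,
    Nat.add_sub_cancel, sum_empty, sum_singleton, pow_zero, one_mul, Nat.succ_ne_zero, if_false]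
  congr 1
  split_ifs with h
  · rw [qBinom_eq_zero_of_lt (by omega), mul_zero]
  · rw [qBinom, Nat.sub_sub]

/-- The `q`-binomial theorem. -/
theorem prod_one_add_X_pow_mul (n : ℕ) (t : ℤ[X][X]) :
    ∏ i ∈ range n, (1 + C (X ^ i) * t) =
      ∑ k ∈ range (n + 1), C (X ^ (k.choose 2) * qBinom n k) * t ^ k := by
  induction n generalizing t with
  | zero => simp [qBinom_zero_right]
  | succ n ih =>
    have h (i : ℕ) : C (X ^ (i + 1)) * t = C (X ^ i) * (C (X : ℤ[X]) * t) := by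
      rw [pow_succ, C_mul, mul_assoc]
    rw [Finset.prod_range_succ']
    simp only [h]
    rw [ih, pow_zero, C_1, one_mul, mul_add, mul_one]
    have hext : ∑ k ∈ range (n + 1), C (X ^ (k.choose 2) * qBinom n k) * (C X * t) ^ k =
        ∑ k ∈ range (n + 1 + 1), C (X ^ (k.choose 2) * qBinom n k) * (C X * t) ^ k := by
      rw [Finset.sum_range_succ _ (n + 1), qBinom_eq_zero_of_lt (Nat.lt_succ_self n)]
      simp
    conv_lhs => enter [1]; rw [hext]
    rw [Finset.sum_range_succ', Finset.sum_range_succ' _ (n + 1), add_right_comm,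
      Finset.sum_mul, ← Finset.sum_add_distrib]
    congr 1
    · refine Finset.sum_congr rfl fun k _ => ?_
      rw [qBinom_succ_succ, Nat.choose_succ_succ' k 1, Nat.choose_one_right]
      simp only [C_mul, C_add, C_pow, mul_pow, pow_add]
      ring
    · simp [qBinom_zero_right]

theorem prod_range_sum_eq_prod {j : ℕ} (n : Fin j → ℕ) (t : ℤ[X][X]) :
    ∏ i ∈ range (∑ u, n u), (1 + C (X ^ i) * t) =
      ∏ u, ∏ i ∈ range (n u), (1 + C (X ^ i) * (C (X ^ ∑ v with u < v, n v) * t)) := by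
  induction j with
  | zero => simp
  | succ j ih =>
    have hs (u : Fin j) : ∑ v with u.succ < v, n v = ∑ v with u < v, n v.succ := by
      simp [Finset.sum_filter, Fin.sum_univ_succ]
    have h0 : ∑ v with 0 < v, n v = ∑ v : Fin j, n v.succ := by
      simp [Finset.sum_filter, Fin.sum_univ_succ]
    rw [Fin.prod_univ_succ, Fin.sum_univ_succ, add_comm, Finset.prod_range_add, mul_comm, h0,
      ih fun u => n u.succ]
    simp only [hs]
    refine congrArg (· * _) (Finset.prod_congr rfl fun i _ => ?_)
    rw [add_comm _ i, pow_add, C_mul, mul_assoc]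

theorem choose_two_sum {j : ℕ} (K : Fin j → ℕ) :
    (∑ u, K u).choose 2 = ∑ u, (K u).choose 2 + ∑ u, K u * ∑ v with u < v, K v := by
  induction j with
  | zero => simp
  | succ j ih =>
    have hs (u : Fin j) : ∑ v with u.succ < v, K v = ∑ v with u < v, K v.succ := by
      simp [Finset.sum_filter, Fin.sum_univ_succ]
    have h0 : ∑ v with 0 < v, K v = ∑ v : Fin j, K v.succ := by
      simp [Finset.sum_filter, Fin.sum_univ_succ]
    have hadd (a b : ℕ) : (a + b).choose 2 = a.choose 2 + b.choose 2 + a * b := by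
      induction b with
      | zero => simp
      | succ b ihb =>
        rw [← add_assoc, Nat.choose_succ_succ' (a + b) 1, Nat.choose_succ_succ' b 1, ihb,
          Nat.choose_one_right, Nat.choose_one_right]
        ring
    simp only [Fin.sum_univ_succ, hs, h0, hadd, ih fun u => K u.succ]
    ring

/-- The `q`-Vandermonde identity with several blocks. -/
theorem qBinom_sum {j : ℕ} (n : Fin j → ℕ) (k : ℕ) :
    qBinom (∑ i, n i) k =
      ∑ K ∈ (Fintype.piFinset fun i => Iic (n i)) with ∑ i, K i = k,
        X ^ (∑ u, K u * ∑ i with u < i, (n i - K i)) * ∏ i, qBinom (n i) (K i) := by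
  have h := prod_range_sum_eq_prod n X
  simp only [prod_one_add_X_pow_mul] at h
  have hr (a : ℕ) : range (a + 1) = Iic a := by ext; simp
  simp only [hr, Finset.prod_univ_sum] at h
  replace h := congrArg (fun p => p.coeff k) h
  have hprod (K : Fin j → ℕ) :
      ∏ i, C (X ^ (K i).choose 2 * qBinom (n i) (K i)) *
          (C (X ^ ∑ v with i < v, n v) * X) ^ K i =
        (C (X ^ (∑ i, (K i).choose 2 + ∑ i, K i * ∑ v with i < v, n v) *
          ∏ i, qBinom (n i) (K i)) * X ^ ∑ i, K i : ℤ[X][X]) := by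
    rw [← Finset.sum_add_distrib, ← Finset.prod_pow_eq_pow_sum, ← Finset.prod_pow_eq_pow_sum,
      ← Finset.prod_mul_distrib, map_prod, ← Finset.prod_mul_distrib]
    refine Finset.prod_congr rfl fun i _ => ?_
    have hX (c s e : ℕ) (B : ℤ[X]) : X ^ c * B * (X ^ s) ^ e = X ^ (c + e * s) * B := by ring
    rw [mul_pow, ← C_pow, ← mul_assoc, ← C_mul, hX]
  simp only [hprod, finsetSum_coeff, coeff_C_mul_X_pow, eq_comm (a := k)] at h
  rw [← Finset.sum_filter, ← Finset.sum_filter] at h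
  have hl : ∑ a ∈ Iic (∑ i, n i) with a = k, (X ^ a.choose 2 * qBinom (∑ i, n i) a : ℤ[X]) =
      X ^ k.choose 2 * qBinom (∑ i, n i) k := by
    rw [Finset.sum_filter, Finset.sum_ite_eq']
    split_ifs with hk
    · rfl
    · rw [qBinom_eq_zero_of_lt (by simpa using hk), mul_zero]
  rw [hl] at h
  apply mul_left_cancel₀ (pow_ne_zero (k.choose 2) (X_ne_zero (R := ℤ)))
  rw [h, Finset.mul_sum]
  refine Finset.sum_congr rfl fun K hK => ?_
  rw [Finset.mem_filter, Fintype.mem_piFinset] at hK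
  have hexp : ∑ u, K u * ∑ v with u < v, n v =
      ∑ u, K u * ∑ v with u < v, K v + ∑ u, K u * ∑ v with u < v, (n v - K v) := by
    rw [← Finset.sum_add_distrib]
    refine Finset.sum_congr rfl fun u _ => ?_
    rw [← mul_add, ← Finset.sum_add_distrib]
    refine congrArg (K u * ·) (Finset.sum_congr rfl fun v _ => ?_)
    have := Finset.mem_Iic.1 (hK.1 v)
    omega
  rw [← mul_assoc, ← pow_add, ← hK.2, choose_two_sum, hexp, add_assoc]

/-- the `q`-analog of the "apartment complex" identity. For
`n_j ≤ ⋯ ≤ n_1` and `k ≤ n_1 + ⋯ + n_j`,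
`(∏_{i=2}^j [n_{i−1} choose n_i]_q) [n_1+⋯+n_j choose k]_q
  = Σ_K q^{f(K)} [n_1 choose k_1]_q ∏_{i=2}^j [n_{i−1}; n_{i−1}−n_i, n_i−k_i, k_i]_q`,
the sum over tuples `K = (k_1, …, k_j)` with `k_1 + ⋯ + k_j = k`, `k_1 ≤ n_1`,
`k_i ≤ n_i`, and `f(K) = Σ_{u=1}^{j−1} k_u (Σ_{i=u+1}^{j} (n_i − k_i))`.
(Indices are 0-based: `n ⟨0, hj⟩` is `n_1`.) -/
theorem stmt15 (j : ℕ) (hj : 0 < j) (n : Fin j → ℕ)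
    (hmono : ∀ a b : Fin j, a ≤ b → n b ≤ n a) (k : ℕ) (hk : k ≤ ∑ i, n i) :
    (∏ i ∈ Finset.univ.filter (fun i : Fin j => 0 < (i : ℕ)),
        qBinom (n ⟨(i : ℕ) - 1, by have := i.isLt; omega⟩) (n i)) *
      qBinom (∑ i, n i) k
    =
    ∑ K ∈ (Fintype.piFinset fun i => Finset.Iic (n i)).filter
        (fun K : Fin j → ℕ => ∑ i, K i = k),
      X ^ (∑ u ∈ Finset.univ.filter (fun u : Fin j => (u : ℕ) + 1 < j),
            K u * ∑ i ∈ Finset.univ.filter (fun i => u < i), (n i - K i)) *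
        qBinom (n ⟨0, hj⟩) (K ⟨0, hj⟩) *
          ∏ i ∈ Finset.univ.filter (fun i : Fin j => 0 < (i : ℕ)),
            qMultinomial (n ⟨(i : ℕ) - 1, by have := i.isLt; omega⟩) 3
              ![n ⟨(i : ℕ) - 1, by have := i.isLt; omega⟩ - n i, n i - K i, K i] := by
  rw [qBinom_sum, Finset.mul_sum]
  refine Finset.sum_congr rfl fun K hK => ?_
  rw [Finset.mem_filter, Fintype.mem_piFinset] at hK
  have hKn (i : Fin j) : K i ≤ n i := Finset.mem_Iic.1 (hK.1 i)
  have hmult : ∏ i ∈ Finset.univ.filter (fun i : Fin j => 0 < (i : ℕ)),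
      qMultinomial (n ⟨(i : ℕ) - 1, by have := i.isLt; omega⟩) 3
        ![n ⟨(i : ℕ) - 1, by have := i.isLt; omega⟩ - n i, n i - K i, K i] =
      (∏ i ∈ Finset.univ.filter (fun i : Fin j => 0 < (i : ℕ)),
        qBinom (n ⟨(i : ℕ) - 1, by have := i.isLt; omega⟩) (n i)) *
      ∏ i ∈ Finset.univ.filter (fun i : Fin j => 0 < (i : ℕ)), qBinom (n i) (K i) := by
    rw [← Finset.prod_mul_distrib]
    refine Finset.prod_congr rfl fun i _ => qMultinomial_three_eq_mul (hmono _ _ ?_) (hKn i)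
    exact Fin.mk_le_of_le_val (Nat.sub_le _ _)
  have hexp : ∑ u ∈ Finset.univ.filter (fun u : Fin j => (u : ℕ) + 1 < j),
      K u * ∑ i ∈ Finset.univ.filter (fun i => u < i), (n i - K i) =
      ∑ u, K u * ∑ i with u < i, (n i - K i) := by
    refine Finset.sum_filter_of_ne fun u _ hu => ?_
    obtain ⟨i, hi, -⟩ := Finset.exists_ne_zero_of_sum_ne_zero (right_ne_zero_of_mul hu)
    have hlt : (u : ℕ) < i := (Finset.mem_filter.1 hi).2
    omega
  have herase : Finset.univ.filter (fun i : Fin j => 0 < (i : ℕ)) =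
      Finset.univ.erase ⟨0, hj⟩ := by
    ext i
    simp [Fin.ext_iff, Nat.pos_iff_ne_zero]
  rw [hmult, hexp, ← Finset.mul_prod_erase _ _ (Finset.mem_univ (⟨0, hj⟩ : Fin j)), ← herase]
  ring
end

section
/- Let m, n, k be nonnegative integers with n − m + 1 ≥ k + 1. Let M(n, m+1, k) = {σ ∈ S(n, m+1) : maj(σ) = k}, and for i ∈ {1, …, m−1} let A_i = {σ ∈ M(n, m+1, k) : σ_{n−m+i} = σ_{n−m+i+1}}, and let A_m = {σ ∈ M(n, m+1, k) : σ_n = m+1}. Then for every subset J of {1, …, m} with |J| = i, the cardinality of the intersection ∩_{j ∈ J} A_j equals the cardinality of M(n − i, m+1, k). -/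
open Finset

/-- The major index of a sequence `σ`: the sum of the (1-based) positions `a` such that
`σ_a > σ_{a+1}`. -/
def majStat {n m : ℕ} (σ : Fin n → Fin m) : ℕ :=
  ∑ a : Fin n,
    if h : (a : ℕ) + 1 < n then
      (if σ ⟨(a : ℕ) + 1, h⟩ < σ a then (a : ℕ) + 1 else 0)
    else 0

/-- Extend a finite sequence to `ℕ` by the largest letter. -/
def topExtend {n m : ℕ} (σ : Fin n → Fin (m + 1)) (a : ℕ) : Fin (m + 1) :=
  if h : a < n then σ ⟨a, h⟩ else Fin.last m

theorem topExtend_of_le {n m : ℕ} (σ : Fin n → Fin (m + 1)) {a : ℕ} (h : n ≤ a) :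
    topExtend σ a = Fin.last m :=
  dif_neg (by omega)

theorem topExtend_coe {n m : ℕ} (σ : Fin n → Fin (m + 1)) (a : Fin n) :
    topExtend σ a = σ a :=
  dif_pos a.isLt

theorem majStat_eq_sum_topExtend {n m : ℕ} (σ : Fin n → Fin (m + 1)) :
    majStat σ =
      ∑ a ∈ range n, if topExtend σ (a + 1) < topExtend σ a then a + 1 else 0 := by
  rw [majStat, Finset.sum_range]
  refine Finset.sum_congr rfl fun a _ => ?_
  by_cases h : (a : ℕ) + 1 < n
  · rw [dif_pos h, topExtend_coe, topExtend, dif_pos h]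
  · rw [dif_neg h, topExtend_of_le σ (by omega), if_neg (not_lt.mpr (Fin.le_last _))]

/-- There is no descent beyond the major index. -/
theorem topExtend_le_succ {n m : ℕ} (σ : Fin n → Fin (m + 1)) {a : ℕ} (h : majStat σ ≤ a) :
    topExtend σ a ≤ topExtend σ (a + 1) := by
  by_contra! hlt
  have ha : a < n := by
    by_contra! hn
    rw [topExtend_of_le σ (by omega : n ≤ a + 1)] at hlt
    exact absurd hlt (not_lt.mpr (Fin.le_last _))
  have := Finset.single_le_sum
    (f := fun a => if topExtend σ (a + 1) < topExtend σ a then a + 1 else 0)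
    (fun _ _ => Nat.zero_le _) (mem_range.mpr ha)
  rw [← majStat_eq_sum_topExtend] at this
  simp only [if_pos hlt] at this
  omega

/-- Sequences that agree up to position `j`, neither having a descent from `j` on, have the
same major index. -/
theorem majStat_congr {n n' m j : ℕ} {σ : Fin n → Fin (m + 1)} {τ : Fin n' → Fin (m + 1)}
    (hn : j ≤ n) (hn' : j ≤ n') (heq : ∀ a ≤ j, topExtend σ a = topExtend τ a)
    (hσ : ∀ a, j ≤ a → topExtend σ a ≤ topExtend σ (a + 1))
    (hτ : ∀ a, j ≤ a → topExtend τ a ≤ topExtend τ (a + 1)) :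
    majStat σ = majStat τ := by
  have truncate : ∀ {l : ℕ} (ρ : Fin l → Fin (m + 1)), j ≤ l →
      (∀ a, j ≤ a → topExtend ρ a ≤ topExtend ρ (a + 1)) →
      majStat ρ =
        ∑ a ∈ range j, if topExtend ρ (a + 1) < topExtend ρ a then a + 1 else 0 := by
    intro l ρ hl hρ
    rw [majStat_eq_sum_topExtend]
    refine (Finset.sum_subset (range_subset_range.mpr hl) fun a _ ha => ?_).symm
    exact if_neg (not_lt.mpr (hρ a (by simpa using ha)))
  rw [truncate σ hn hσ, truncate τ hn' hτ]
  refine Finset.sum_congr rfl fun a ha => ?_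
  have := mem_range.mp ha
  rw [heq a (by omega), heq (a + 1) (by omega)]

/-- Delete the entry at position `j`. -/
def deleteAt {n m : ℕ} (j : ℕ) (σ : Fin (n + 1) → Fin (m + 1)) (a : Fin n) : Fin (m + 1) :=
  topExtend σ (if (a : ℕ) < j then a else a + 1)

/-- Repeat the entry at position `j`. -/
def repeatAt {n m : ℕ} (j : ℕ) (σ : Fin n → Fin (m + 1)) (a : Fin (n + 1)) : Fin (m + 1) :=
  topExtend σ (if (a : ℕ) ≤ j then a else a - 1)

theorem topExtend_deleteAt {n m j : ℕ} (hj : j ≤ n) (σ : Fin (n + 1) → Fin (m + 1)) (a : ℕ) :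
    topExtend (deleteAt j σ) a = topExtend σ (if a < j then a else a + 1) := by
  by_cases h : a < n
  · exact dif_pos h
  · rw [topExtend_of_le _ (by omega), topExtend_of_le]
    split_ifs <;> omega

theorem topExtend_repeatAt {n m j : ℕ} (σ : Fin n → Fin (m + 1)) (a : ℕ) :
    topExtend (repeatAt j σ) a = topExtend σ (if a ≤ j then a else a - 1) := by
  by_cases h : a < n + 1
  · exact dif_pos h
  · rw [topExtend_of_le _ (by omega), topExtend_of_le]
    split_ifs <;> omega

theorem topExtend_injective {n m : ℕ} {σ τ : Fin n → Fin (m + 1)}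
    (h : ∀ a, topExtend σ a = topExtend τ a) : σ = τ := by
  funext a
  rw [← topExtend_coe σ, ← topExtend_coe τ, h]

theorem topExtend_deleteAt_of_le {n m j a : ℕ} (hj : j ≤ n) {σ : Fin (n + 1) → Fin (m + 1)}
    (h : topExtend σ j = topExtend σ (j + 1)) (ha : a ≤ j) :
    topExtend (deleteAt j σ) a = topExtend σ a := by
  rw [topExtend_deleteAt hj]
  split_ifs with hlt
  · rfl
  · obtain rfl : a = j := by omega
    exact h.symm

theorem topExtend_repeatAt_of_le {n m j a : ℕ} (σ : Fin n → Fin (m + 1))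
    (ha : a ≤ j) : topExtend (repeatAt j σ) a = topExtend σ a := by
  rw [topExtend_repeatAt, if_pos ha]

theorem majStat_deleteAt {n m j : ℕ} (hj : j ≤ n) {σ : Fin (n + 1) → Fin (m + 1)}
    (h : topExtend σ j = topExtend σ (j + 1)) (hmaj : majStat σ ≤ j) :
    majStat (deleteAt j σ) = majStat σ := by
  refine majStat_congr hj (by omega) (fun a => topExtend_deleteAt_of_le hj h) ?_
    fun a ha => topExtend_le_succ σ (by omega)
  intro a ha
  rw [topExtend_deleteAt hj, topExtend_deleteAt hj, if_neg (by omega), if_neg (by omega)]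
  exact topExtend_le_succ σ (by omega)

theorem majStat_repeatAt {n m j : ℕ} (hj : j ≤ n) {σ : Fin n → Fin (m + 1)}
    (hmaj : majStat σ ≤ j) : majStat (repeatAt j σ) = majStat σ := by
  refine majStat_congr (by omega) hj (fun a => topExtend_repeatAt_of_le σ) ?_
    fun a ha => topExtend_le_succ σ (by omega)
  intro a ha
  rw [topExtend_repeatAt, topExtend_repeatAt, if_neg (by omega : ¬ a + 1 ≤ j),
    Nat.add_sub_cancel]
  split_ifs with hle
  · rfl
  · obtain ⟨b, rfl⟩ : ∃ b, a = b + 1 := ⟨a - 1, by omega⟩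
    exact topExtend_le_succ σ (by omega)

theorem deleteAt_repeatAt {n m j : ℕ} (hj : j ≤ n) (σ : Fin n → Fin (m + 1)) :
    deleteAt j (repeatAt j σ) = σ := by
  refine topExtend_injective fun a => ?_
  rw [topExtend_deleteAt hj, topExtend_repeatAt]
  congr 1
  split_ifs <;> omega

theorem repeatAt_deleteAt {n m j : ℕ} (hj : j ≤ n) {σ : Fin (n + 1) → Fin (m + 1)}
    (h : topExtend σ j = topExtend σ (j + 1)) : repeatAt j (deleteAt j σ) = σ := by
  refine topExtend_injective fun a => ?_
  rw [topExtend_repeatAt]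
  split_ifs with ha
  · exact topExtend_deleteAt_of_le hj h ha
  · rw [topExtend_deleteAt hj, if_neg (by omega)]
    congr 1
    omega

/-- Forcing `J.card` adjacent entries beyond position `k` to be equal (the entry after the last one
being the largest letter) is the same, for major index `k`, as shortening the sequence by
`J.card`. -/
theorem card_majStat_filter_topExtend_eq (m k : ℕ) (J : Finset ℕ) :
    ∀ n : ℕ, (∀ j ∈ J, k ≤ j ∧ j < n) →
      (univ.filter fun σ : Fin n → Fin (m + 1) =>
        majStat σ = k ∧ ∀ j ∈ J, topExtend σ j = topExtend σ (j + 1)).card =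
      (univ.filter fun σ : Fin (n - J.card) → Fin (m + 1) => majStat σ = k).card := by
  induction J using Finset.induction_on_max with
  | empty =>
    intro n _
    simp only [notMem_empty, IsEmpty.forall_iff, implies_true, and_true]
    rfl
  | insert j J hlt ih =>
    intro n hn
    obtain ⟨hkj, hjn⟩ := hn j (mem_insert_self j J)
    obtain ⟨n, rfl⟩ : ∃ l, n = l + 1 := ⟨n - 1, by omega⟩
    have hj : j ≤ n := by omega
    rw [card_insert_of_notMem fun hmem => (hlt j hmem).false, Nat.add_sub_add_right,
      ← ih n fun x hx => ⟨(hn x (mem_insert_of_mem hx)).1, (hlt x hx).trans_le hj⟩]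
    refine card_nbij' (deleteAt j) (repeatAt j) ?_ ?_ ?_ ?_
    · intro σ hσ
      simp only [coe_filter, mem_univ, true_and, Set.mem_ofPred_eq, forall_mem_insert] at hσ ⊢
      obtain ⟨hmaj, hσj, hσJ⟩ := hσ
      refine ⟨by rw [majStat_deleteAt hj hσj (by omega), hmaj], fun x hx => ?_⟩
      have := hlt x hx
      rw [topExtend_deleteAt_of_le hj hσj (by omega), topExtend_deleteAt_of_le hj hσj (by omega)]
      exact hσJ x hx
    · intro σ hσ
      simp only [coe_filter, mem_univ, true_and, Set.mem_ofPred_eq, forall_mem_insert] at hσ ⊢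
      obtain ⟨hmaj, hσJ⟩ := hσ
      refine ⟨by rw [majStat_repeatAt hj (by omega), hmaj], ?_, fun x hx => ?_⟩
      · rw [topExtend_repeatAt, topExtend_repeatAt, if_pos le_rfl, if_neg (by omega),
          Nat.add_sub_cancel]
      · have := hlt x hx
        rw [topExtend_repeatAt_of_le σ (by omega), topExtend_repeatAt_of_le σ (by omega)]
        exact hσJ x hx
    · intro σ hσ
      simp only [coe_filter, mem_univ, true_and, Set.mem_ofPred_eq, forall_mem_insert] at hσ
      exact repeatAt_deleteAt hj hσ.2.1
    · intro σ _
      exact deleteAt_repeatAt hj σ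

/-- with `M(n, m+1, k) = {σ ∈ S(n, m+1) : maj σ = k}` and, for
`i ∈ {1, …, m−1}`, `A_i = {σ ∈ M : σ_{n−m+i} = σ_{n−m+i+1}}` and
`A_m = {σ ∈ M : σ_n = m+1}`, any intersection of `i` of the sets `A_1, …, A_m` has the
same cardinality as `M(n−i, m+1, k)`. The hypothesis `n − m + 1 ≥ k + 1` (as integers)
is recorded as `m + k ≤ n`. Entries in `{1, …, m+1}` are encoded as `Fin (m+1)`
(`1 ↦ 0`, …, `m+1 ↦ Fin.last m`), and `A_{j+1}` (for `j : Fin m`) is expressed by the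
condition in the inner filter. -/
theorem stmt17 (m n k : ℕ) (h : m + k ≤ n) (i : ℕ) (J : Finset (Fin m)) (hJ : J.card = i) :
    (((Finset.univ : Finset (Fin n → Fin (m + 1))).filter (fun σ => majStat σ = k)).filter
        (fun σ => ∀ j ∈ J,
          if hj : (j : ℕ) + 1 < m then
            σ ⟨n - m + (j : ℕ), by have := j.isLt; omega⟩ =
              σ ⟨n - m + (j : ℕ) + 1, by have := j.isLt; omega⟩
          else
            σ ⟨n - 1, by have := j.isLt; omega⟩ = Fin.last m)).card
    =
    ((Finset.univ : Finset (Fin (n - i) → Fin (m + 1))).filter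
        (fun σ => majStat σ = k)).card := by
  subst hJ
  have hcard : (J.image fun j : Fin m => n - m + (j : ℕ)).card = J.card :=
    card_image_of_injective _ fun a b hab => Fin.ext (Nat.add_left_cancel hab)
  have key := card_majStat_filter_topExtend_eq m k (J.image fun j : Fin m => n - m + (j : ℕ)) n
    (by
      intro x hx
      obtain ⟨j, -, rfl⟩ := mem_image.mp hx
      have := j.isLt
      omega)
  rw [hcard] at key
  rw [← key, filter_filter]
  congr 1
  refine filter_congr fun σ _ => and_congr_right fun _ => ?_
  rw [forall_mem_image]
  refine forall₂_congr fun j _ => ?_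
  have hjm := j.isLt
  split_ifs with hj
  · rw [topExtend, topExtend, dif_pos (by omega), dif_pos (by omega)]
  · rw [topExtend_of_le σ (by omega : n ≤ n - m + (j : ℕ) + 1), topExtend,
      dif_pos (by omega : n - m + (j : ℕ) < n)]
    simp only [show n - m + (j : ℕ) = n - 1 by omega]
end

section
/- Let m, n, k be nonnegative integers with n ≥ m + k. Then Σ_{i=0}^{m} (−1)^i C(m, i) · |{σ ∈ S(n − i, m+1) : maj(σ) = k}| = |P(k,m)|. Equivalently, writing f(n) for the coefficient of q^k in the generalized Galois number G(n, m+1), the m-th finite difference ∇^m f(n) equals the number of integer partitions of k with m kinds. -/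
open Finset

section QSeries

open PowerSeries

/-- The `q`-Pochhammer product `(1 - q) (1 - q ^ 2) ⋯ (1 - q ^ n)`. -/
noncomputable def qPoch (n : ℕ) : ℤ⟦X⟧ := ∏ i ∈ range n, (1 - X ^ (i + 1))

/-- The generating function of the partitions into parts of size at most `n`. -/
noncomputable def boundedPartGF (n : ℕ) : ℤ⟦X⟧ :=
  PowerSeries.mk fun j => ((Nat.Partition.restricted j (· ≤ n)).card : ℤ)

theorem qPoch_succ (n : ℕ) : qPoch (n + 1) = qPoch n * (1 - X ^ (n + 1)) :=
  prod_range_succ _ _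

open PowerSeries.WithPiTopology in
theorem qPoch_mul_boundedPartGF (n : ℕ) : qPoch n * boundedPartGF n = 1 := by
  have h : boundedPartGF n = ∏ i ∈ range n, ∑' j : ℕ, (X : ℤ⟦X⟧) ^ ((i + 1) * j) := by
    rw [boundedPartGF, Nat.Partition.powerSeriesMk_card_restricted_eq_tprod ℤ (· ≤ n),
      tprod_eq_prod (s := range n)]
    · exact prod_congr rfl fun i hi => if_pos (mem_range.mp hi)
    · intro i hi
      exact if_neg fun h => hi (mem_range.mpr h)
  rw [h, qPoch, ← prod_mul_distrib]
  refine prod_eq_one fun i _ => ?_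
  simp_rw [pow_mul]
  rw [mul_comm]
  exact tsum_pow_mul_one_sub_of_constantCoeff_eq_zero (by simp)

theorem boundedPartGF_zero : boundedPartGF 0 = 1 := by
  simpa [qPoch] using qPoch_mul_boundedPartGF 0

theorem one_sub_mul_boundedPartGF_succ (n : ℕ) :
    (1 - X ^ (n + 1)) * boundedPartGF (n + 1) = boundedPartGF n := by
  linear_combination boundedPartGF n * qPoch_mul_boundedPartGF (n + 1) -
    (1 - X ^ (n + 1)) * boundedPartGF (n + 1) * qPoch_mul_boundedPartGF n -
    boundedPartGF n * boundedPartGF (n + 1) * qPoch_succ n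

/-- Beyond degree `a`, the factors of `qPoch` do not affect the coefficient of `q ^ k`. -/
theorem coeff_qPoch_mul_of_le {k a n : ℕ} (hk : k ≤ a) (han : a ≤ n) (f : ℤ⟦X⟧) :
    coeff k (qPoch n * f) = coeff k (qPoch a * f) := by
  induction n, han using Nat.le_induction with
  | base => rfl
  | succ n hn ih =>
    have h : qPoch (n + 1) * f = qPoch n * f - X ^ (n + 1) * (qPoch n * f) := by
      rw [qPoch_succ]; ring
    rw [h, map_sub, coeff_X_pow_mul', if_neg (by omega), sub_zero, ih]

/-- The geometric series `1 / (1 - x)` over `ℤ⟦q⟧`. -/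
noncomputable def geomSeries : ℤ⟦X⟧⟦X⟧ := PowerSeries.mk 1

/-- The series `1 / ((1 - x q) (1 - x q ^ 2) ⋯)`, in Euler's expansion. -/
noncomputable def eulerSeries : ℤ⟦X⟧⟦X⟧ := rescale X (PowerSeries.mk boundedPartGF)

theorem geomSeries_mul : geomSeries * (1 - X) = 1 :=
  PowerSeries.mk_one_mul_one_sub_eq_one _

theorem coeff_eulerSeries (j : ℕ) : coeff j eulerSeries = X ^ j * boundedPartGF j := by
  simp [eulerSeries, coeff_rescale]

theorem one_sub_mul_mk_boundedPartGF :
    (1 - X) * PowerSeries.mk boundedPartGF = eulerSeries := by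
  ext1 j
  rw [coeff_eulerSeries, sub_mul, one_mul, map_sub]
  cases j with
  | zero => simp
  | succ j =>
    rw [coeff_succ_X_mul, coeff_mk, coeff_mk]
    linear_combination one_sub_mul_boundedPartGF_succ j

theorem geomSeries_mul_eulerSeries :
    geomSeries * eulerSeries = PowerSeries.mk boundedPartGF := by
  rw [← one_sub_mul_mk_boundedPartGF, ← mul_assoc, geomSeries_mul, one_mul]

theorem eulerSeries_eq_rescale :
    eulerSeries = rescale X geomSeries * rescale X eulerSeries := by
  rw [← map_mul, geomSeries_mul_eulerSeries, eulerSeries]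

theorem X_mul_sum_geomSeries_pow {a b : ℕ} (h : a ≤ b) :
    X * ∑ i ∈ Ico a b, geomSeries ^ (i + 1) = geomSeries ^ b - geomSeries ^ a := by
  rw [← sum_Ico_sub _ h, mul_sum]
  refine sum_congr rfl fun i _ => ?_
  linear_combination -geomSeries ^ i * geomSeries_mul

/-- The series whose `n`-th coefficient, times `qPoch n`, is the generating function of the words
of length `n` in `M` letters followed by the letter `b`. -/
noncomputable def wordSeries (M b : ℕ) : ℤ⟦X⟧⟦X⟧ := geomSeries ^ (b + 1) * eulerSeries ^ M

theorem X_mul_sum_wordSeries (M : ℕ) {a b : ℕ} (h : a ≤ b) :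
    X * ∑ i ∈ Ico a b, wordSeries M i =
      (geomSeries ^ b - geomSeries ^ a) * eulerSeries ^ M := by
  simp_rw [wordSeries]
  rw [← sum_mul, ← mul_assoc, X_mul_sum_geomSeries_pow h]

theorem wordSeries_sub_rescale {M b : ℕ} (hb : b < M) :
    wordSeries M b - rescale X (wordSeries M b) =
      X * ∑ i ∈ Ico 0 (b + 1), wordSeries M i +
        rescale X (X * ∑ i ∈ Ico (b + 1) M, wordSeries M i) := by
  rw [X_mul_sum_wordSeries M (Nat.zero_le _), X_mul_sum_wordSeries M (show b + 1 ≤ M from hb), wordSeries]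
  simp only [map_mul, map_sub, map_pow]
  have h : eulerSeries ^ M = rescale X geomSeries ^ M * rescale X eulerSeries ^ M := by
    rw [← mul_pow, ← eulerSeries_eq_rescale]
  linear_combination h

theorem qPoch_succ_mul_coeff_wordSeries {M b : ℕ} (hb : b < M) (n : ℕ) :
    qPoch (n + 1) * coeff (n + 1) (wordSeries M b) =
      ∑ a ∈ range M, qPoch n * coeff n (wordSeries M a) * (if b < a then X ^ (n + 1) else 1) := by
  have h := congrArg (coeff (n + 1)) (wordSeries_sub_rescale hb)
  simp only [map_sub, map_add, coeff_rescale, coeff_succ_X_mul, map_sum] at h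
  rw [range_eq_Ico, ← sum_Ico_consecutive _ (Nat.zero_le _) hb,
    sum_congr (s₁ := Ico 0 (b + 1)) rfl fun a ha => by
      rw [if_neg (by have := mem_Ico.mp ha; omega), mul_one],
    sum_congr (s₁ := Ico (b + 1) M) rfl fun a ha => by
      rw [if_pos (by have := mem_Ico.mp ha; omega)],
    ← mul_sum, ← sum_mul, ← mul_sum, qPoch_succ]
  linear_combination qPoch n * h

theorem coeff_succ_geomSeries_mul (f : ℤ⟦X⟧⟦X⟧) (n : ℕ) :
    coeff (n + 1) (geomSeries * f) = coeff n (geomSeries * f) + coeff (n + 1) f := by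
  have h : geomSeries * f = X * (geomSeries * f) + f := by
    linear_combination f * geomSeries_mul
  conv_lhs => rw [h]
  rw [map_add, coeff_succ_X_mul]

theorem dvd_coeff_geomSeries_mul_sub {f : ℤ⟦X⟧⟦X⟧} (hf : ∀ j, X ^ j ∣ coeff j f) {l n : ℕ}
    (h : l ≤ n) :
    X ^ (l + 1) ∣ coeff n (geomSeries * f) - coeff l (geomSeries * f) := by
  induction n, h using Nat.le_induction with
  | base => simp
  | succ n hn ih =>
    rw [coeff_succ_geomSeries_mul, add_sub_right_comm]
    exact dvd_add ih ((pow_dvd_pow _ (by omega)).trans (hf _))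

/-- Setting `x = 1` is multiplicative modulo `q ^ (n + 1)`. -/
theorem dvd_coeff_geomSeries_mul_mul_sub {f g : ℤ⟦X⟧⟦X⟧} (hf : ∀ j, X ^ j ∣ coeff j f)
    (hg : ∀ j, X ^ j ∣ coeff j g) (n : ℕ) :
    X ^ (n + 1) ∣ coeff n (geomSeries * f) * coeff n (geomSeries * g) -
      coeff n (geomSeries * (f * g)) := by
  have h₁ : coeff n (geomSeries * f) = ∑ p ∈ antidiagonal n, coeff p.1 f := by
    rw [mul_comm, coeff_mul]
    simp [geomSeries]
  rw [h₁, mul_left_comm, coeff_mul n f, sum_mul, ← sum_sub_distrib]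
  refine dvd_sum fun p hp => ?_
  have hp' := mem_antidiagonal.mp hp
  rw [← mul_sub, ← hp', add_assoc, pow_add]
  exact mul_dvd_mul (hf _) (dvd_coeff_geomSeries_mul_sub hg (by omega))

theorem dvd_coeff_eulerSeries_pow (s j : ℕ) : X ^ j ∣ coeff j (eulerSeries ^ s) := by
  rw [eulerSeries, ← map_pow, coeff_rescale]
  exact dvd_mul_right _ _

theorem dvd_boundedPartGF_pow_sub (n s : ℕ) :
    X ^ (n + 1) ∣ boundedPartGF n ^ s - coeff n (geomSeries * eulerSeries ^ s) := by
  induction s with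
  | zero => simp [geomSeries]
  | succ s ih =>
    have h := dvd_coeff_geomSeries_mul_mul_sub (dvd_coeff_eulerSeries_pow s)
      (fun j => by simpa using dvd_coeff_eulerSeries_pow 1 j) n
    rw [geomSeries_mul_eulerSeries, coeff_mk, ← pow_succ] at h
    have h' := dvd_add (ih.mul_right (boundedPartGF n)) h
    convert h' using 1
    ring

theorem sum_choose_mul_coeff_wordSeries {m n : ℕ} (h : m ≤ n) :
    ∑ i ∈ range (m + 1), (-1) ^ i * (m.choose i : ℤ⟦X⟧) * coeff (n - i) (wordSeries (m + 1) m) =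
      coeff n (geomSeries * eulerSeries ^ (m + 1)) := by
  have h₁ : geomSeries * eulerSeries ^ (m + 1) = (1 - X) ^ m * wordSeries (m + 1) m := by
    have : (geomSeries * (1 - X)) ^ m = 1 := by rw [geomSeries_mul, one_pow]
    rw [wordSeries]
    rw [mul_pow] at this
    linear_combination -geomSeries * eulerSeries ^ (m + 1) * this
  have h₂ : (1 - X : ℤ⟦X⟧⟦X⟧) ^ m =
      ∑ i ∈ range (m + 1), C ((-1) ^ i * (m.choose i : ℤ⟦X⟧)) * X ^ i := by
    rw [sub_eq_neg_add, add_pow]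
    refine sum_congr rfl fun i _ => ?_
    rw [neg_pow]
    simp only [map_mul, map_pow, map_neg, map_one, map_natCast, one_pow]
    ring
  rw [h₁, h₂, sum_mul, map_sum]
  refine sum_congr rfl fun i hi => ?_
  have := mem_range.mp hi
  rw [mul_assoc (C _), coeff_C_mul, coeff_X_pow_mul', if_pos (by omega)]

theorem coeff_boundedPartGF {j n : ℕ} (h : j ≤ n) :
    coeff j (boundedPartGF n) = (Fintype.card j.Partition : ℤ) := by
  rw [boundedPartGF, coeff_mk, Nat.Partition.restricted, filter_true_of_mem, card_univ]
  exact fun p _ i hi => (Nat.Partition.le_of_mem_parts hi).trans h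

/-- Sorting the partitions with several kinds by the sums of their components. -/
noncomputable def partitionKindsEquiv (m k : ℕ) :
    {P : Fin m → Multiset ℕ // (∀ i, ∀ x ∈ P i, 0 < x) ∧ (∑ i, (P i).sum) = k} ≃
      Σ l : finsuppAntidiag (univ : Finset (Fin m)) k, ∀ i, (l.1 i).Partition where
  toFun P := ⟨⟨Finsupp.equivFunOnFinite.symm fun i => (P.1 i).sum, by simp [P.2.2]⟩,
    fun i => ⟨P.1 i, fun h => P.2.1 i _ h, rfl⟩⟩
  invFun Q := ⟨fun i => (Q.2 i).parts, fun i _ h => (Q.2 i).parts_pos h, by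
    simpa [Nat.Partition.parts_sum] using (mem_finsuppAntidiag.mp Q.1.2).1⟩
  left_inv _ := rfl
  right_inv := by
    rintro ⟨⟨l, hl⟩, p⟩
    obtain ⟨P, hpos, hsum, rfl⟩ : ∃ (P : Fin m → Multiset ℕ) (hpos : ∀ i {x}, x ∈ P i → 0 < x)
        (hsum : ∀ i, (P i).sum = l i), p = fun i => ⟨P i, hpos i, hsum i⟩ :=
      ⟨fun i => (p i).parts, fun i => (p i).parts_pos, fun i => (p i).parts_sum, rfl⟩
    obtain rfl : l = Finsupp.equivFunOnFinite.symm fun i => (P i).sum :=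
      Finsupp.ext fun i => (hsum i).symm
    rfl

theorem card_partitionKinds {k n : ℕ} (m : ℕ) (h : k ≤ n) :
    (Nat.card {P : Fin m → Multiset ℕ //
        (∀ i, ∀ x ∈ P i, 0 < x) ∧ (∑ i, (P i).sum) = k} : ℤ) = coeff k (boundedPartGF n ^ m) := by
  have h₁ : boundedPartGF n ^ m = ∏ _i : Fin m, boundedPartGF n := by simp
  rw [Nat.card_congr (partitionKindsEquiv m k), Nat.card_eq_fintype_card, Fintype.card_sigma,
    h₁, coeff_prod, ← sum_coe_sort (finsuppAntidiag _ _)]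
  push_cast
  refine sum_congr rfl fun l _ => ?_
  rw [Fintype.card_pi]
  push_cast
  refine prod_congr rfl fun i _ => (coeff_boundedPartGF ?_).symm
  have hl : ∑ i, l.1 i = k := (mem_finsuppAntidiag.mp l.2).1
  have hi : l.1 i ≤ ∑ i, l.1 i := single_le_sum (fun _ _ => Nat.zero_le _) (mem_univ i)
  omega

end QSeries

section Words

open PowerSeries

theorem majStat_snoc {n M : ℕ} (τ : Fin (n + 1) → Fin M) (b : Fin M) :
    majStat (Fin.snoc τ b : Fin (n + 2) → Fin M) =
      majStat τ + if b < τ (Fin.last n) then n + 1 else 0 := by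
  have hcast : ∀ (a : ℕ) (h : a < n + 1),
      (Fin.snoc τ b : Fin (n + 2) → Fin M) ⟨a, h.trans (Nat.lt_succ_self _)⟩ = τ ⟨a, h⟩ :=
    fun a h => Fin.snoc_castSucc (α := fun _ => Fin M) b τ ⟨a, h⟩
  have hlast : (Fin.snoc τ b : Fin (n + 2) → Fin M) ⟨n + 1, Nat.lt_succ_self _⟩ = b :=
    Fin.snoc_last (α := fun _ => Fin M) b τ
  simp only [majStat]
  rw [Fin.sum_univ_castSucc, dif_neg (by simp), add_zero, Fin.sum_univ_castSucc,
    Fin.sum_univ_castSucc (n := n), dif_neg (c := (Fin.last n : ℕ) + 1 < n + 1) (by simp),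
    add_zero]
  refine congrArg₂ _ ?_ ?_
  · refine sum_congr rfl fun a _ => ?_
    have ha := a.2
    rw [dif_pos (by simp), dif_pos (by simp)]
    simp only [Fin.castSucc, Fin.castAdd, Fin.castLE]
    rw [hcast _ (by omega), hcast _ (by omega)]
  · rw [dif_pos (by simp)]
    simp only [Fin.castSucc, Fin.castAdd, Fin.castLE, Fin.val_last]
    rw [hlast, hcast _ (Nat.lt_succ_self n)]
    rfl

theorem majStat_snoc_last {n m : ℕ} (σ : Fin n → Fin (m + 1)) :
    majStat (Fin.snoc σ (Fin.last m) : Fin (n + 1) → Fin (m + 1)) = majStat σ := by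
  cases n with
  | zero => simp [majStat]
  | succ n => rw [majStat_snoc, if_neg (Fin.le_last _).not_gt, add_zero]

theorem sum_pow_majStat_snoc {M : ℕ} (n : ℕ) (b : Fin M) :
    ∑ σ : Fin n → Fin M, (X : ℤ⟦X⟧) ^ majStat (Fin.snoc σ b : Fin (n + 1) → Fin M) =
      qPoch n * coeff n (wordSeries M b) := by
  induction n generalizing b with
  | zero =>
    have h : constantCoeff eulerSeries = 1 := by
      rw [← coeff_zero_eq_constantCoeff_apply, coeff_eulerSeries, boundedPartGF_zero]
      simp
    simp [majStat, qPoch, wordSeries, geomSeries, h]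
  | succ n ih =>
    rw [qPoch_succ_mul_coeff_wordSeries b.2,
      ← Fin.sum_univ_eq_sum_range (fun a => qPoch n * coeff n (wordSeries M a) *
        (if (b : ℕ) < a then X ^ (n + 1) else 1)),
      ← (Fin.snocEquiv fun _ => Fin M).sum_comp, Fintype.sum_prod_type]
    refine sum_congr rfl fun a _ => ?_
    rw [← ih a, sum_mul]
    refine sum_congr rfl fun σ _ => ?_
    have h := majStat_snoc (Fin.snoc σ a : Fin (n + 1) → Fin M) b
    rw [Fin.snoc_last] at h
    change X ^ majStat (Fin.snoc (Fin.snoc σ a : Fin (n + 1) → Fin M) b : Fin (n + 2) → Fin M) = _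
    rw [h, pow_add]
    simp only [Fin.lt_def]
    split_ifs <;> simp

/-- MacMahon's formula for the generalized Galois numbers. -/
theorem sum_pow_majStat (n m : ℕ) :
    ∑ σ : Fin n → Fin (m + 1), (X : ℤ⟦X⟧) ^ majStat σ =
      qPoch n * coeff n (wordSeries (m + 1) m) := by
  simpa [majStat_snoc_last] using sum_pow_majStat_snoc n (Fin.last m)

theorem card_majStat_eq (n m k : ℕ) :
    (((univ : Finset (Fin n → Fin (m + 1))).filter (fun σ => majStat σ = k)).card : ℤ) =
      coeff k (qPoch n * coeff n (wordSeries (m + 1) m)) := by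
  rw [← sum_pow_majStat, map_sum]
  simp [coeff_X_pow, eq_comm]

end Words

/-- for `n ≥ m + k`, the alternating sum
`Σ_{i=0}^{m} (−1)^i C(m,i) |{σ ∈ S(n−i, m+1) : maj σ = k}|` — i.e. the `m`-th finite
difference at `n` of the coefficient of `q^k` in the generalized Galois number
`G(·, m+1)` — equals the number of integer partitions of `k` with `m` kinds
(`m`-tuples of multisets of positive integers whose elements sum to `k`). -/
theorem stmt18 (m n k : ℕ) (h : n ≥ m + k) :
    (∑ i ∈ Finset.range (m + 1),
      (-1 : ℤ) ^ i * (m.choose i) *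
        (((Finset.univ : Finset (Fin (n - i) → Fin (m + 1))).filter
            (fun σ => majStat σ = k)).card : ℤ))
    =
    (Nat.card {P : Fin m → Multiset ℕ //
        (∀ i, ∀ x ∈ P i, 0 < x) ∧ (∑ i, (P i).sum) = k} : ℤ) := by
  have h₁ : ∀ i ∈ range (m + 1), (-1 : ℤ) ^ i * (m.choose i) *
        (((univ : Finset (Fin (n - i) → Fin (m + 1))).filter
            (fun σ => majStat σ = k)).card : ℤ) =
      PowerSeries.coeff k (qPoch n * ((-1) ^ i * (m.choose i : PowerSeries ℤ) *
        PowerSeries.coeff (n - i) (wordSeries (m + 1) m))) := by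
    intro i hi
    have := mem_range.mp hi
    rw [card_majStat_eq, ← coeff_qPoch_mul_of_le (by omega) (Nat.sub_le n i),
      ← PowerSeries.coeff_C_mul]
    congr 1
    simp only [map_mul, map_pow, map_neg, map_one, map_natCast]
    ring
  obtain ⟨d, hd⟩ := dvd_boundedPartGF_pow_sub n (m + 1)
  have h₂ : qPoch n * PowerSeries.coeff n (geomSeries * eulerSeries ^ (m + 1)) =
      boundedPartGF n ^ m - PowerSeries.X ^ (n + 1) * (qPoch n * d) := by
    linear_combination boundedPartGF n ^ m * qPoch_mul_boundedPartGF n - qPoch n * hd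
  rw [sum_congr rfl h₁, ← map_sum, ← mul_sum, sum_choose_mul_coeff_wordSeries (by omega), h₂,
    map_sub, PowerSeries.coeff_X_pow_mul', if_neg (by omega), sub_zero,
    card_partitionKinds m (by omega : k ≤ n)]
end
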